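/- arXiv:2111.03766 — 3 statements merged into one kernel-verified Lean document; each statement's English description precedes it below -/
import Mathlib

section
/- Fix V > 0 and a Bond number B > 0, and set κ := √B, Υ(κ) := I₁(κ)L₀(κ) − I₀(κ)L₁(κ), d₀ := [3πΥ(κ) + 2B·I₀(κ) − 6√B·I₁(κ)]/(3B·I₂(κ)), and λ*₀ := (18V/π)·[6d₀ − 3 + 18(1−d₀)πΥ(κ)/(B·I₀(κ)) + 3·₂F₃(1,2;3/2,5/2,3;B/4) − 9π²L₀(κ)Υ(κ)/(B^{3/2}·I₀(κ))]^{−1}. Then for every h ∈ M_V, the squared fundamental shallow sloshing frequency for purely radial motions satisfies λ_{0,1}(h) := Ω_{0,1}(h)² ≤ λ*₀. -/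
/-- Modified Bessel function of the first kind of (natural) order `n`,
`I_n(x) = sum_k (x/2)^(2k+n) / (k! * Gamma (k+n+1))`. -/
noncomputable def besselI (n : ℕ) (x : ℝ) : ℝ :=
  ∑' k : ℕ, (x / 2) ^ (2 * k + n) / ((k.factorial : ℝ) * Real.Gamma (k + n + 1))

/-- Modified Struve function of the first kind of (natural) order `n`,
`L_n(x) = sum_k (x/2)^(2k+n+1) / (Gamma (k+3/2) * Gamma (k+n+3/2))`. -/
noncomputable def struveL (n : ℕ) (x : ℝ) : ℝ :=
  ∑' k : ℕ, (x / 2) ^ (2 * k + n + 1) /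
    (Real.Gamma (k + 3 / 2) * Real.Gamma (k + n + 3 / 2))

/-- Rising factorial (Pochhammer symbol) `(a)_k`. -/
noncomputable def risingFactorial (a : ℝ) (k : ℕ) : ℝ :=
  ∏ i ∈ Finset.range k, (a + i)

/-- The generalized hypergeometric function `2F3(1, 2; 3/2, 5/2, 3; z)`. -/
noncomputable def hyp2F3 (z : ℝ) : ℝ :=
  ∑' k : ℕ, risingFactorial 1 k * risingFactorial 2 k /
    (risingFactorial (3 / 2) k * risingFactorial (5 / 2) k * risingFactorial 3 k) *
    z ^ k / (k.factorial : ℝ)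

/-- `h in M_V`: continuous, nonnegative on `[0,1]`, with integral of h(r) r dr = V/(2 pi). -/
def MemMV (V : ℝ) (h : ℝ → ℝ) : Prop :=
  ContinuousOn h (Set.Icc (0 : ℝ) 1) ∧ (∀ r ∈ Set.Icc (0 : ℝ) 1, 0 ≤ h r) ∧
    (∫ r in (0 : ℝ)..1, h r * r) = V / (2 * Real.pi)

/-- The energy E0(h; psi, zeta) for purely radial sloshing motions (m = 0). -/
noncomputable def energyR0 (B : ℝ) (h ψ ζ : ℝ → ℝ) : ℝ :=
  (1 / 2) * (∫ r in (0 : ℝ)..1, h r * (deriv ψ r) ^ 2 * r) +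
    (1 / 2) * (∫ r in (0 : ℝ)..1, ((ζ r) ^ 2 + (1 / B) * (deriv ζ r) ^ 2) * r)

/-- The fundamental shallow sloshing frequency for purely radial motions (m = 0). -/
noncomputable def OmegaR0 (B : ℝ) (h : ℝ → ℝ) : ℝ :=
  sInf {E : ℝ | ∃ ψ ζ : ℝ → ℝ, ContDiff ℝ 1 ψ ∧ ContDiff ℝ 1 ζ ∧ ζ 1 = 0 ∧
    (∫ r in (0 : ℝ)..1, ζ r * r) = 0 ∧
    (∫ r in (0 : ℝ)..1, ψ r * ζ r * r) = 1 ∧ E = energyR0 B h ψ ζ}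

/-- The even or odd power series `∑ c k * (x / 2) ^ (2 k + m)`. -/
noncomputable def halfSeries (c : ℕ → ℝ) (m : ℕ) (x : ℝ) : ℝ :=
  ∑' k : ℕ, c k * (x / 2) ^ (2 * k + m)

theorem summable_mul_half_pow {c : ℕ → ℝ} {C : ℝ} (hc : ∀ k, |c k| ≤ C / k.factorial)
    (m : ℕ) (x : ℝ) : Summable fun k => c k * (x / 2) ^ (2 * k + m) := by
  have h := ((Real.summable_pow_div_factorial ((x / 2) ^ 2)).mul_left C).mul_right (|x / 2| ^ m)
  refine Summable.of_norm_bounded h fun k => ?_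
  rw [Real.norm_eq_abs, abs_mul, abs_pow, pow_add, pow_mul, sq_abs]
  have := mul_le_mul_of_nonneg_right (hc k)
    (show 0 ≤ ((x / 2) ^ 2) ^ k * |x / 2| ^ m by positivity)
  refine this.trans (le_of_eq ?_)
  ring

theorem hasDerivAt_halfSeries {c : ℕ → ℝ} {C : ℝ} (hc : ∀ k, |c k| ≤ C / k.factorial)
    (m : ℕ) (x : ℝ) :
    HasDerivAt (halfSeries c m)
      (∑' k : ℕ, c k * ((2 * k + m : ℕ) / 2 * (x / 2) ^ (2 * k + m - 1))) x := by
  set R : ℝ := |x| / 2 + 1 with hR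
  have hR1 : 1 ≤ R := by rw [hR]; linarith [abs_nonneg x]
  have hC : 0 ≤ C := by simpa using (abs_nonneg _).trans (hc 0)
  have hu : Summable fun k : ℕ => C * (2 ^ m * R ^ m) * ((2 * R) ^ 2) ^ k / k.factorial := by
    simpa only [mul_div_assoc] using
      (Real.summable_pow_div_factorial ((2 * R) ^ 2)).mul_left (C * (2 ^ m * R ^ m))
  have hterm : ∀ (k : ℕ) (y : ℝ), HasDerivAt (fun y : ℝ => c k * (y / 2) ^ (2 * k + m))
      (c k * ((2 * k + m : ℕ) / 2 * (y / 2) ^ (2 * k + m - 1))) y := fun k y => by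
    have h1 : HasDerivAt (fun y : ℝ => y / 2) (1 / 2) y := (hasDerivAt_id y).div_const 2
    refine ((h1.pow (2 * k + m)).const_mul (c k)).congr_deriv ?_
    ring
  have hbound : ∀ (k : ℕ) (y : ℝ), y ∈ Metric.ball (0 : ℝ) (2 * R) →
      ‖c k * ((2 * k + m : ℕ) / 2 * (y / 2) ^ (2 * k + m - 1))‖ ≤
        C * (2 ^ m * R ^ m) * ((2 * R) ^ 2) ^ k / k.factorial := fun k y hy => by
    have hy' : |y / 2| ≤ R := by
      rw [mem_ball_zero_iff, Real.norm_eq_abs] at hy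
      rw [abs_div, abs_two]; linarith
    rw [Real.norm_eq_abs, abs_mul, abs_mul, abs_pow]
    have hn : |((2 * k + m : ℕ) : ℝ) / 2| ≤ 2 ^ (2 * k + m) := by
      rw [abs_of_nonneg (by positivity)]
      have : ((2 * k + m : ℕ) : ℝ) ≤ 2 ^ (2 * k + m) := by
        exact_mod_cast (Nat.lt_two_pow_self).le
      have h0 : (0 : ℝ) ≤ ((2 * k + m : ℕ) : ℝ) := by positivity
      linarith
    have hp : |y / 2| ^ (2 * k + m - 1) ≤ R ^ (2 * k + m) :=
      (pow_le_pow_left₀ (abs_nonneg _) hy' _).trans (pow_le_pow_right₀ hR1 (Nat.sub_le _ _))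
    calc _ ≤ C / k.factorial * (2 ^ (2 * k + m) * R ^ (2 * k + m)) := by
            gcongr
            exact hc k
      _ = _ := by rw [pow_add, pow_add, pow_mul, pow_mul, mul_pow, mul_pow]; ring
  have h0 : (0 : ℝ) ∈ Metric.ball (0 : ℝ) (2 * R) := Metric.mem_ball_self (by linarith)
  have hx : x ∈ Metric.ball (0 : ℝ) (2 * R) := by
    rw [mem_ball_zero_iff, Real.norm_eq_abs]; linarith
  exact hasDerivAt_tsum_of_isPreconnected hu Metric.isOpen_ball
    (convex_ball _ _).isPreconnected (fun k y _ => hterm k y) hbound h0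
    (summable_mul_half_pow hc m 0) hx

theorem factorial_mul_Gamma_le {a : ℝ} (ha : 1 ≤ a) (k : ℕ) :
    (k.factorial : ℝ) * Real.Gamma a ≤ Real.Gamma (k + a) := by
  induction k with
  | zero => simp
  | succ k ih =>
    have h0 : 0 < Real.Gamma a := Real.Gamma_pos_of_pos (by linarith)
    have hk : (0 : ℝ) ≤ k := k.cast_nonneg
    rw [show ((k + 1 : ℕ) : ℝ) + a = (k + a) + 1 by push_cast; ring,
      Real.Gamma_add_one (by positivity), Nat.factorial_succ]
    push_cast
    rw [mul_assoc]
    exact mul_le_mul (by linarith) ih (by positivity) (by positivity)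

/-- The coefficients shared by the modified Bessel and Struve series. -/
noncomputable def gammaCoeff (a b : ℝ) (k : ℕ) : ℝ :=
  1 / (Real.Gamma (k + a) * Real.Gamma (k + b))

theorem gammaCoeff_pos {a b : ℝ} (ha : 0 < a) (hb : 0 < b) (k : ℕ) : 0 < gammaCoeff a b k := by
  have h1 := Real.Gamma_pos_of_pos (show 0 < k + a by positivity)
  have h2 := Real.Gamma_pos_of_pos (show 0 < k + b by positivity)
  unfold gammaCoeff
  positivity

theorem abs_gammaCoeff_le {a b : ℝ} (ha : 1 ≤ a) (hb : 1 ≤ b) (k : ℕ) :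
    |gammaCoeff a b k| ≤ 1 / (Real.Gamma a * Real.Gamma b) / k.factorial := by
  rw [abs_of_pos (gammaCoeff_pos (by linarith) (by linarith) k), gammaCoeff, div_div]
  have hka := factorial_mul_Gamma_le ha k
  have hkb := factorial_mul_Gamma_le hb k
  have h1 := Real.Gamma_pos_of_pos (show 0 < a by linarith)
  have h2 := Real.Gamma_pos_of_pos (show 0 < b by linarith)
  have hf : (1 : ℝ) ≤ k.factorial := by exact_mod_cast k.factorial_pos
  apply one_div_le_one_div_of_le (by positivity)
  calc _ = (k.factorial * Real.Gamma a) * (1 * Real.Gamma b) := by ring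
    _ ≤ (k.factorial * Real.Gamma a) * (k.factorial * Real.Gamma b) := by gcongr
    _ ≤ _ := mul_le_mul hka hkb (by positivity) ((by positivity : (0:ℝ) ≤ _).trans hka)

theorem gammaCoeff_add_one {a b : ℝ} (hb : 0 < b) (k : ℕ) :
    gammaCoeff a b k = (k + b) * gammaCoeff a (b + 1) k := by
  have h : (k : ℝ) + b ≠ 0 := by positivity
  rw [gammaCoeff, gammaCoeff, ← add_assoc, Real.Gamma_add_one h]
  field_simp

theorem gammaCoeff_succ (a b : ℝ) (k : ℕ) :
    gammaCoeff a b (k + 1) = gammaCoeff (a + 1) (b + 1) k := by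
  simp only [gammaCoeff]
  push_cast
  ring_nf

theorem gammaCoeff_comm (a b : ℝ) (k : ℕ) : gammaCoeff a b k = gammaCoeff b a k := by
  simp only [gammaCoeff, mul_comm]

theorem summable_gammaCoeff {a b : ℝ} (ha : 1 ≤ a) (hb : 1 ≤ b) (m : ℕ) (x : ℝ) :
    Summable fun k => gammaCoeff a b k * (x / 2) ^ (2 * k + m) :=
  summable_mul_half_pow (abs_gammaCoeff_le ha hb) m x

theorem halfSeries_gammaCoeff_pos {a b : ℝ} (ha : 1 ≤ a) (hb : 1 ≤ b) (m : ℕ) {x : ℝ}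
    (hx : 0 < x) : 0 < halfSeries (gammaCoeff a b) m x := by
  have h : ∀ k, 0 < gammaCoeff a b k * (x / 2) ^ (2 * k + m) := fun k =>
    mul_pos (gammaCoeff_pos (by linarith) (by linarith) k) (by positivity)
  exact (summable_gammaCoeff ha hb m x).tsum_pos (fun k => (h k).le) 0 (h 0)

theorem besselI_eq (n : ℕ) : besselI n = halfSeries (gammaCoeff 1 (n + 1)) n := by
  funext x
  refine tsum_congr fun k => ?_
  rw [gammaCoeff, Real.Gamma_nat_eq_factorial, ← add_assoc]
  ring

theorem struveL_eq (n : ℕ) :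
    struveL n = halfSeries (gammaCoeff (3 / 2) (n + 3 / 2)) (n + 1) := by
  funext x
  refine tsum_congr fun k => ?_
  rw [gammaCoeff, ← add_assoc, ← add_assoc]
  ring

theorem continuous_halfSeries_gammaCoeff {a b : ℝ} (ha : 1 ≤ a) (hb : 1 ≤ b) (m : ℕ) :
    Continuous (halfSeries (gammaCoeff a b) m) :=
  continuous_iff_continuousAt.2 fun x =>
    (hasDerivAt_halfSeries (abs_gammaCoeff_le ha hb) m x).continuousAt

theorem continuous_besselI (n : ℕ) : Continuous (besselI n) := by
  rw [besselI_eq]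
  exact continuous_halfSeries_gammaCoeff le_rfl (by linarith [n.cast_nonneg (α := ℝ)]) _

theorem continuous_struveL (n : ℕ) : Continuous (struveL n) := by
  rw [struveL_eq]
  exact continuous_halfSeries_gammaCoeff (by norm_num) (by linarith [n.cast_nonneg (α := ℝ)]) _

theorem besselI_pos (n : ℕ) {x : ℝ} (hx : 0 < x) : 0 < besselI n x := by
  rw [besselI_eq]
  exact halfSeries_gammaCoeff_pos le_rfl (by linarith [n.cast_nonneg (α := ℝ)]) _ hx

theorem hasDerivAt_besselI_zero (x : ℝ) : HasDerivAt (besselI 0) (besselI 1 x) x := by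
  have h := hasDerivAt_halfSeries (abs_gammaCoeff_le le_rfl (le_refl (1 : ℝ))) 0 x
  set f : ℕ → ℝ := fun k =>
    gammaCoeff 1 1 k * (((2 * k + 0 : ℕ) : ℝ) / 2 * (x / 2) ^ (2 * k + 0 - 1)) with hf
  have key : ∀ k : ℕ, f (k + 1) = gammaCoeff 1 2 k * (x / 2) ^ (2 * k + 1) := fun k => by
    have h1 := gammaCoeff_add_one (a := 2) one_pos k
    rw [gammaCoeff_comm] at h1
    simp only [hf]
    rw [gammaCoeff_succ, show 2 * (k + 1) + 0 - 1 = 2 * k + 1 by omega]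
    norm_num at h1 ⊢
    rw [h1]
    ring
  have hs : Summable f := (summable_nat_add_iff 1).1
    ((summable_gammaCoeff (le_refl (1 : ℝ)) one_le_two 1 x).congr fun k => (key k).symm)
  have h0 : f 0 = 0 := by simp [hf]
  have e : ∑' k, f k = besselI 1 x := by
    rw [hs.tsum_eq_zero_add, h0, zero_add, besselI_eq, halfSeries]
    refine tsum_congr fun k => ?_
    rw [key]
    norm_num
  rw [e] at h
  rw [besselI_eq]
  norm_num
  exact h

theorem Gamma_three_halves : Real.Gamma (3 / 2) = Real.sqrt Real.pi / 2 := by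
  rw [show (3 / 2 : ℝ) = 1 / 2 + 1 by norm_num, Real.Gamma_add_one (by norm_num),
    Real.Gamma_one_half_eq]
  ring

theorem hasDerivAt_struveL_zero (x : ℝ) :
    HasDerivAt (struveL 0) (struveL 1 x + 2 / Real.pi) x := by
  have h := hasDerivAt_halfSeries (abs_gammaCoeff_le (a := 3 / 2) (b := 3 / 2)
    (by norm_num) (by norm_num)) 1 x
  set f : ℕ → ℝ := fun k => gammaCoeff (3 / 2) (3 / 2) k *
    (((2 * k + 1 : ℕ) : ℝ) / 2 * (x / 2) ^ (2 * k + 1 - 1)) with hf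
  have key : ∀ k : ℕ, f (k + 1) =
      gammaCoeff (3 / 2) (5 / 2) k * (x / 2) ^ (2 * k + 2) := fun k => by
    have h1 := gammaCoeff_add_one (a := 5 / 2) (b := 3 / 2) (by norm_num) k
    rw [gammaCoeff_comm] at h1
    simp only [hf]
    rw [gammaCoeff_succ, show 2 * (k + 1) + 1 - 1 = 2 * k + 2 by omega]
    norm_num at h1 ⊢
    rw [h1]
    ring
  have hs : Summable f := (summable_nat_add_iff 1).1
    ((summable_gammaCoeff (a := 3 / 2) (b := 5 / 2) (by norm_num) (by norm_num) 2 x).congr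
      fun k => (key k).symm)
  have h0 : f 0 = 2 / Real.pi := by
    simp only [hf, gammaCoeff]
    norm_num [Gamma_three_halves]
    rw [← sq, div_pow, Real.sq_sqrt Real.pi_pos.le]
    field_simp
  have e : ∑' k, f k = struveL 1 x + 2 / Real.pi := by
    rw [hs.tsum_eq_zero_add, h0, struveL_eq, halfSeries, add_comm]
    congr 1
    refine tsum_congr fun k => ?_
    rw [key]
    norm_num
  rw [e] at h
  rw [struveL_eq]
  norm_num
  exact h

theorem hasDerivAt_mul_besselI_one (x : ℝ) :
    HasDerivAt (fun y => y * besselI 1 y) (x * besselI 0 x) x := by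
  have h := (hasDerivAt_halfSeries (abs_gammaCoeff_le (le_refl (1 : ℝ)) one_le_two) 2 x).const_mul 2
  have e : (fun y => 2 * halfSeries (gammaCoeff 1 2) 2 y) = fun y => y * besselI 1 y := by
    funext y
    rw [besselI_eq, halfSeries, halfSeries, ← tsum_mul_left, ← tsum_mul_left]
    norm_num
    refine tsum_congr fun k => ?_
    ring
  rw [e] at h
  refine h.congr_deriv ?_
  rw [besselI_eq, halfSeries, ← tsum_mul_left, ← tsum_mul_left]
  refine tsum_congr fun k => ?_
  have h1 := gammaCoeff_add_one (a := 1) one_pos k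
  norm_num at h1 ⊢
  rw [h1]
  ring

theorem hasDerivAt_mul_struveL_one (x : ℝ) :
    HasDerivAt (fun y => y * struveL 1 y) (x * struveL 0 x) x := by
  have h := (hasDerivAt_halfSeries (abs_gammaCoeff_le (a := 3 / 2) (b := 5 / 2)
    (by norm_num) (by norm_num)) 3 x).const_mul 2
  have e : (fun y => 2 * halfSeries (gammaCoeff (3 / 2) (5 / 2)) 3 y) =
      fun y => y * struveL 1 y := by
    funext y
    rw [struveL_eq, halfSeries, halfSeries, ← tsum_mul_left, ← tsum_mul_left]
    norm_num
    refine tsum_congr fun k => ?_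
    ring
  rw [e] at h
  refine h.congr_deriv ?_
  rw [struveL_eq, halfSeries, ← tsum_mul_left, ← tsum_mul_left]
  refine tsum_congr fun k => ?_
  have h1 := gammaCoeff_add_one (a := 3 / 2) (b := 3 / 2) (by norm_num) k
  norm_num at h1 ⊢
  rw [h1]
  ring

/-- An antiderivative of `x * struveL 1 x` vanishing at the origin. -/
noncomputable def struvePrimitive (x : ℝ) : ℝ :=
  halfSeries (fun k => gammaCoeff (3 / 2) (5 / 2) k * (2 / (k + 2))) 4 x

theorem hasDerivAt_struvePrimitive (x : ℝ) :
    HasDerivAt struvePrimitive (x * struveL 1 x) x := by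
  have hb := abs_gammaCoeff_le (a := 3 / 2) (b := 5 / 2) (by norm_num) (by norm_num)
  have h := hasDerivAt_halfSeries
    (c := fun k : ℕ => gammaCoeff (3 / 2) (5 / 2) k * (2 / (k + 2))) (fun k => by
      refine le_trans ?_ (hb k)
      rw [abs_mul]
      refine mul_le_of_le_one_right (abs_nonneg _) ?_
      rw [abs_of_nonneg (by positivity)]
      exact (div_le_one (by positivity)).2 (by linarith [k.cast_nonneg (α := ℝ)])) 4 x
  refine h.congr_deriv ?_
  rw [struveL_eq, halfSeries, ← tsum_mul_left]
  refine tsum_congr fun k => ?_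
  rw [show 2 * k + 4 - 1 = 2 * k + 3 by omega]
  have : (k : ℝ) + 2 ≠ 0 := by positivity
  norm_num
  field_simp
  ring

theorem two_mul_besselI_one_add (x : ℝ) :
    2 * besselI 1 x + x * besselI 2 x = x * besselI 0 x := by
  set f : ℕ → ℝ := fun k =>
    k * gammaCoeff 1 2 k * (x / 2) ^ (2 * k) with hf
  have key : ∀ k : ℕ, f (k + 1) = gammaCoeff 1 3 k * (x / 2) ^ (2 * k + 2) := fun k => by
    have h1 := gammaCoeff_add_one (a := 3) one_pos k
    rw [gammaCoeff_comm] at h1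
    simp only [hf]
    rw [gammaCoeff_succ, show 2 * (k + 1) = 2 * k + 2 by omega]
    norm_num at h1 ⊢
    rw [h1]
    simp [gammaCoeff_comm 2 3]
  have hs' := summable_gammaCoeff (le_refl (1 : ℝ)) (by norm_num : (1 : ℝ) ≤ 3) 2 x
  have hs : Summable f := (summable_nat_add_iff 1).1 (hs'.congr fun k => (key k).symm)
  have h0 : f 0 = 0 := by simp [hf]
  have e : besselI 2 x = ∑' k, f k := by
    rw [hs.tsum_eq_zero_add, h0, zero_add, besselI_eq, halfSeries]
    refine tsum_congr fun k => ?_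
    rw [key]
    norm_num
  have hs1 := summable_gammaCoeff (le_refl (1 : ℝ)) one_le_two 1 x
  rw [e, besselI_eq, besselI_eq, halfSeries, halfSeries]
  norm_num
  rw [← tsum_mul_left, ← tsum_mul_left, ← tsum_mul_left,
    ← (hs1.mul_left 2).tsum_add (hs.mul_left x)]
  refine tsum_congr fun k => ?_
  have h1 := gammaCoeff_add_one (a := 1) one_pos k
  norm_num at h1
  simp only [hf]
  rw [h1]
  ring

theorem risingFactorial_pos {a : ℝ} (ha : 0 < a) (k : ℕ) : 0 < risingFactorial a k :=
  Finset.prod_pos fun i _ => by positivity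

theorem Gamma_mul_risingFactorial {a : ℝ} (ha : 0 < a) (k : ℕ) :
    Real.Gamma a * risingFactorial a k = Real.Gamma (k + a) := by
  induction k with
  | zero => simp [risingFactorial]
  | succ k ih =>
    rw [risingFactorial, Finset.prod_range_succ, ← risingFactorial, ← mul_assoc, ih]
    push_cast
    rw [show (k : ℝ) + 1 + a = (k + a) + 1 by ring, Real.Gamma_add_one (by positivity)]
    ring

theorem risingFactorial_one (k : ℕ) : risingFactorial 1 k = k.factorial := by
  have h := Gamma_mul_risingFactorial one_pos k
  rwa [Real.Gamma_one, one_mul, Real.Gamma_nat_eq_factorial] at h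

theorem risingFactorial_three (k : ℕ) :
    risingFactorial 3 k = risingFactorial 2 k * ((k + 2) / 2) := by
  induction k with
  | zero => simp [risingFactorial]
  | succ k ih =>
    rw [risingFactorial, Finset.prod_range_succ, ← risingFactorial, ih, risingFactorial,
      risingFactorial, Finset.prod_range_succ]
    push_cast
    ring

theorem struvePrimitive_eq (x : ℝ) :
    struvePrimitive x = x ^ 4 / (6 * Real.pi) * hyp2F3 (x ^ 2 / 4) := by
  have hG5 : Real.Gamma (5 / 2) = 3 / 2 * Real.Gamma (3 / 2) := by
    rw [show (5 / 2 : ℝ) = 3 / 2 + 1 by norm_num, Real.Gamma_add_one (by norm_num)]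
  have hpi := Real.pi_pos
  have hGG : Real.Gamma (3 / 2) * Real.Gamma (5 / 2) = 3 * Real.pi / 8 := by
    rw [hG5, Gamma_three_halves]
    linear_combination (3 / 8) * Real.mul_self_sqrt hpi.le
  rw [struvePrimitive, halfSeries, hyp2F3, ← tsum_mul_left]
  refine tsum_congr fun k => ?_
  have p2 := risingFactorial_pos two_pos k
  have p3 := risingFactorial_pos (a := 3 / 2) (by norm_num) k
  have p5 := risingFactorial_pos (a := 5 / 2) (by norm_num) k
  have hf : (0 : ℝ) < k.factorial := by exact_mod_cast k.factorial_pos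
  have hk : (0 : ℝ) < k + 2 := by positivity
  have e : gammaCoeff (3 / 2) (5 / 2) k =
      8 / (3 * Real.pi * (risingFactorial (3 / 2) k * risingFactorial (5 / 2) k)) := by
    rw [gammaCoeff, ← Gamma_mul_risingFactorial (by norm_num),
      ← Gamma_mul_risingFactorial (by norm_num), mul_mul_mul_comm, hGG]
    field_simp
  rw [e, risingFactorial_one, risingFactorial_three, pow_add, pow_mul,
    show (x / 2) ^ 2 = x ^ 2 / 4 by ring]
  field_simp
  ring

theorem hasDerivAt_struveBesselWronskian (x : ℝ) :
    HasDerivAt (fun y => y * (besselI 1 y * struveL 0 y - besselI 0 y * struveL 1 y))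
      (2 / Real.pi * (x * besselI 1 x)) x := by
  have h := ((hasDerivAt_mul_besselI_one x).mul (hasDerivAt_struveL_zero x)).sub
    ((hasDerivAt_besselI_zero x).mul (hasDerivAt_mul_struveL_one x))
  refine (h.congr_deriv (by ring)).congr_of_eventuallyEq (Filter.Eventually.of_forall fun y => ?_)
  simp
  ring

theorem sq_OmegaR0_le {V B S : ℝ} (hV : 0 < V) (hB : 0 < B) (hS : 0 < S) {h ζ : ℝ → ℝ}
    (hh : MemMV V h) (hζ : ContDiff ℝ 1 ζ) (h1 : ζ 1 = 0)
    (hmean : (∫ r in (0 : ℝ)..1, ζ r * r) = 0)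
    (hmoment : (∫ r in (0 : ℝ)..1, r * ζ r * r) = S)
    (henergy : (∫ r in (0 : ℝ)..1, ((ζ r) ^ 2 + (1 / B) * (deriv ζ r) ^ 2) * r) = S) :
    OmegaR0 B h ^ 2 ≤ V / (2 * Real.pi * S) := by
  have hpi := Real.pi_pos
  obtain ⟨-, hpos, hvol⟩ := hh
  set q : ℝ := Real.sqrt (V / (2 * Real.pi * S)) with hq
  have hq2 : q ^ 2 = V / (2 * Real.pi * S) := Real.sq_sqrt (by positivity)
  have hq0 : 0 < q := Real.sqrt_pos.2 (by positivity)
  set b : ℝ := Real.sqrt (q / S) with hb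
  have hb2 : b ^ 2 = q / S := Real.sq_sqrt (by positivity)
  have hb0 : 0 < b := Real.sqrt_pos.2 (by positivity)
  have hnonneg : ∀ E ∈ {E : ℝ | ∃ ψ ζ : ℝ → ℝ, ContDiff ℝ 1 ψ ∧ ContDiff ℝ 1 ζ ∧ ζ 1 = 0 ∧
      (∫ r in (0 : ℝ)..1, ζ r * r) = 0 ∧
      (∫ r in (0 : ℝ)..1, ψ r * ζ r * r) = 1 ∧ E = energyR0 B h ψ ζ}, 0 ≤ E := by
    rintro E ⟨ψ, η, -, -, -, -, -, rfl⟩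
    have i1 : 0 ≤ ∫ r in (0 : ℝ)..1, h r * (deriv ψ r) ^ 2 * r :=
      intervalIntegral.integral_nonneg zero_le_one fun r hr =>
        mul_nonneg (mul_nonneg (hpos r hr) (sq_nonneg _)) hr.1
    have i2 : 0 ≤ ∫ r in (0 : ℝ)..1, ((η r) ^ 2 + (1 / B) * (deriv η r) ^ 2) * r :=
      intervalIntegral.integral_nonneg zero_le_one fun r hr =>
        mul_nonneg (by positivity) hr.1
    unfold energyR0
    positivity
  have hle : OmegaR0 B h ≤ q := by
    refine csInf_le ⟨0, hnonneg⟩ ⟨fun r => (1 / (b * S)) * r, fun r => b * ζ r,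
      contDiff_const.mul contDiff_id, contDiff_const.mul hζ, by simp [h1], ?_, ?_, ?_⟩
    · simp_rw [mul_assoc b]
      rw [intervalIntegral.integral_const_mul, hmean, mul_zero]
    · have : ∀ r, 1 / (b * S) * r * (b * ζ r) * r = 1 / S * (r * ζ r * r) := fun r => by
        field_simp
      simp_rw [this]
      rw [intervalIntegral.integral_const_mul, hmoment]
      field_simp
    · have d1 : ∀ r : ℝ, deriv (fun r => (1 / (b * S)) * r) r = 1 / (b * S) := fun r => by simp
      have d2 : ∀ r : ℝ, deriv (fun r => b * ζ r) r = b * deriv ζ r := fun r =>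
        deriv_const_mul _ (hζ.differentiable one_ne_zero r)
      have e1 : ∀ r, h r * (1 / (b * S)) ^ 2 * r = (1 / (b * S)) ^ 2 * (h r * r) := fun r => by
        ring
      have e2 : ∀ r, ((b * ζ r) ^ 2 + 1 / B * (b * deriv ζ r) ^ 2) * r =
          b ^ 2 * (((ζ r) ^ 2 + (1 / B) * (deriv ζ r) ^ 2) * r) := fun r => by ring
      simp_rw [energyR0, d1, d2, e1, e2]
      rw [intervalIntegral.integral_const_mul, intervalIntegral.integral_const_mul, hvol,
        henergy, div_pow, mul_pow, hb2]
      have hV' : V = q ^ 2 * (2 * Real.pi * S) := by rw [hq2]; field_simp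
      rw [hV']
      field_simp
      ring
  rw [← hq2]
  exact pow_le_pow_left₀ (Real.sInf_nonneg hnonneg) hle 2

/-- The meniscus shape `r - c - π / (2 κ) * L₀ (κ r) + A * I₀ (κ r)`. -/
noncomputable def meniscus (κ c A r : ℝ) : ℝ :=
  r - c - Real.pi / (2 * κ) * struveL 0 (κ * r) + A * besselI 0 (κ * r)

/-- The derivative of `meniscus`. -/
noncomputable def meniscusSlope (κ A r : ℝ) : ℝ :=
  A * κ * besselI 1 (κ * r) - Real.pi / 2 * struveL 1 (κ * r)

section meniscus

variable {κ : ℝ} (c A : ℝ)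

theorem hasDerivAt_comp_mul_left {f : ℝ → ℝ} {f' k x : ℝ} (hf : HasDerivAt f f' (k * x)) :
    HasDerivAt (fun y => f (k * y)) (k * f') x := by
  have h := hf.comp x ((hasDerivAt_id x).const_mul k)
  exact h.congr_deriv (by ring)

theorem hasDerivAt_meniscus (hκ : 0 < κ) (r : ℝ) :
    HasDerivAt (meniscus κ c A) (meniscusSlope κ A r) r := by
  have hI := hasDerivAt_comp_mul_left (hasDerivAt_besselI_zero (κ * r))
  have hL := hasDerivAt_comp_mul_left (hasDerivAt_struveL_zero (κ * r))
  refine ((((hasDerivAt_id r).sub_const c).sub (hL.const_mul (Real.pi / (2 * κ)))).add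
    (hI.const_mul A)).congr_deriv ?_
  have := Real.pi_pos
  unfold meniscusSlope
  field_simp
  ring

theorem continuous_meniscusSlope : Continuous (meniscusSlope κ A) :=
  (continuous_const.mul ((continuous_besselI 1).comp (continuous_const_mul κ))).sub
    (continuous_const.mul ((continuous_struveL 1).comp (continuous_const_mul κ)))

theorem deriv_meniscus (hκ : 0 < κ) : deriv (meniscus κ c A) = meniscusSlope κ A :=
  funext fun r => (hasDerivAt_meniscus c A hκ r).deriv

theorem contDiff_meniscus (hκ : 0 < κ) : ContDiff ℝ 1 (meniscus κ c A) :=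
  contDiff_one_iff_deriv.2 ⟨fun r => (hasDerivAt_meniscus c A hκ r).differentiableAt,
    by rw [deriv_meniscus c A hκ]; exact continuous_meniscusSlope A⟩

theorem hasDerivAt_mul_meniscusSlope (hκ : 0 < κ) (r : ℝ) :
    HasDerivAt (fun s => s * meniscusSlope κ A s)
      (κ ^ 2 * (r * (meniscus κ c A r - r + c))) r := by
  have hI := hasDerivAt_comp_mul_left (hasDerivAt_mul_besselI_one (κ * r))
  have hL := hasDerivAt_comp_mul_left (hasDerivAt_mul_struveL_one (κ * r))
  refine ((hI.const_mul A).sub (hL.const_mul (Real.pi / (2 * κ)))).congr_deriv ?_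
    |>.congr_of_eventuallyEq (Filter.Eventually.of_forall fun s => ?_)
  · unfold meniscus
    field_simp
    ring
  · simp [meniscusSlope]
    field_simp

theorem integral_meniscus_mul (hκ : 0 < κ) :
    (∫ r in (0 : ℝ)..1, meniscus κ c A r * r) =
      1 / 3 - c / 2 - Real.pi / (2 * κ ^ 2) * struveL 1 κ + A * besselI 1 κ / κ := by
  have hI := fun r => hasDerivAt_comp_mul_left (hasDerivAt_mul_besselI_one (κ * r))
  have hL := fun r => hasDerivAt_comp_mul_left (hasDerivAt_mul_struveL_one (κ * r))
  have hd : ∀ r ∈ Set.uIcc (0 : ℝ) 1, HasDerivAt (fun r => r ^ 3 / 3 - c * (r ^ 2 / 2) -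
      Real.pi / (2 * κ ^ 3) * (κ * r * struveL 1 (κ * r)) +
      A / κ ^ 2 * (κ * r * besselI 1 (κ * r))) (meniscus κ c A r * r) r := fun r _ => by
    refine (((((hasDerivAt_pow 3 r).div_const 3).sub
      (((hasDerivAt_pow 2 r).div_const 2).const_mul c)).sub
      ((hL r).const_mul (Real.pi / (2 * κ ^ 3)))).add
      ((hI r).const_mul (A / κ ^ 2))).congr_deriv ?_
    unfold meniscus
    field_simp
    norm_num
    ring
  rw [intervalIntegral.integral_eq_sub_of_hasDerivAt hd
    (((contDiff_meniscus c A hκ).continuous.mul continuous_id).intervalIntegrable _ _)]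
  norm_num
  field_simp

theorem integral_mul_meniscus_mul (hκ : 0 < κ) :
    (∫ r in (0 : ℝ)..1, r * meniscus κ c A r * r) =
      1 / 4 - c / 3 - Real.pi / (2 * κ ^ 2) * struveL 1 κ + hyp2F3 (κ ^ 2 / 4) / 12 +
      A * (besselI 1 κ / κ - Real.pi / (2 * κ ^ 2) *
        (besselI 1 κ * struveL 0 κ - besselI 0 κ * struveL 1 κ)) := by
  have hI := fun r => hasDerivAt_comp_mul_left (hasDerivAt_mul_besselI_one (κ * r))
  have hL := fun r => hasDerivAt_comp_mul_left (hasDerivAt_mul_struveL_one (κ * r))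
  have hG := fun r => hasDerivAt_comp_mul_left (hasDerivAt_struvePrimitive (κ * r))
  have hW := fun r => hasDerivAt_comp_mul_left (hasDerivAt_struveBesselWronskian (κ * r))
  have hpi := Real.pi_pos
  have hd : ∀ r ∈ Set.uIcc (0 : ℝ) 1, HasDerivAt (fun r => r ^ 4 / 4 - c * (r ^ 3 / 3) -
      Real.pi / (2 * κ ^ 4) * (κ * (r * (κ * r * struveL 1 (κ * r))) - struvePrimitive (κ * r)) +
      A / κ ^ 3 * (κ * (r * (κ * r * besselI 1 (κ * r))) - Real.pi / 2 *
        (κ * r * (besselI 1 (κ * r) * struveL 0 (κ * r) - besselI 0 (κ * r) * struveL 1 (κ * r)))))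
      (r * meniscus κ c A r * r) r := fun r _ => by
    refine (((((hasDerivAt_pow 4 r).div_const 4).sub
      (((hasDerivAt_pow 3 r).div_const 3).const_mul c)).sub
      (((((hasDerivAt_id r).mul (hL r)).const_mul κ).sub (hG r)).const_mul
        (Real.pi / (2 * κ ^ 4)))).add
      (((((hasDerivAt_id r).mul (hI r)).const_mul κ).sub
        ((hW r).const_mul (Real.pi / 2))).const_mul (A / κ ^ 3))).congr_deriv ?_
    unfold meniscus
    simp only [id]
    field_simp
    norm_num
    ring
  have hc : Continuous fun r => r * meniscus κ c A r * r :=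
    (continuous_id.mul (contDiff_meniscus c A hκ).continuous).mul continuous_id
  rw [intervalIntegral.integral_eq_sub_of_hasDerivAt hd (hc.intervalIntegrable _ _)]
  norm_num [struvePrimitive_eq]
  field_simp
  ring

variable {c A}

theorem integral_energy_meniscus (hκ : 0 < κ) (h1 : meniscus κ c A 1 = 0)
    (hmean : (∫ r in (0 : ℝ)..1, meniscus κ c A r * r) = 0) :
    (∫ r in (0 : ℝ)..1, ((meniscus κ c A r) ^ 2 +
      (1 / κ ^ 2) * (deriv (meniscus κ c A) r) ^ 2) * r) =
      ∫ r in (0 : ℝ)..1, r * meniscus κ c A r * r := by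
  have hc := (contDiff_meniscus c A hκ).continuous
  have hs : Continuous (meniscusSlope κ A) := continuous_meniscusSlope A
  rw [deriv_meniscus c A hκ]
  have hd : ∀ r ∈ Set.uIcc (0 : ℝ) 1, HasDerivAt
      (fun r => 1 / κ ^ 2 * (r * meniscusSlope κ A r * meniscus κ c A r))
      (((meniscus κ c A r) ^ 2 + (1 / κ ^ 2) * (meniscusSlope κ A r) ^ 2) * r -
        r * meniscus κ c A r * r + c * (meniscus κ c A r * r)) r := fun r _ => by
    refine (((hasDerivAt_mul_meniscusSlope c A hκ r).mul
      (hasDerivAt_meniscus c A hκ r)).const_mul (1 / κ ^ 2)).congr_deriv ?_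
    field_simp
    ring
  have i1 : IntervalIntegrable (fun r => ((meniscus κ c A r) ^ 2 +
      (1 / κ ^ 2) * (meniscusSlope κ A r) ^ 2) * r) MeasureTheory.volume 0 1 :=
    Continuous.intervalIntegrable (by fun_prop) _ _
  have i2 : IntervalIntegrable (fun r => r * meniscus κ c A r * r) MeasureTheory.volume 0 1 :=
    Continuous.intervalIntegrable (by fun_prop) _ _
  have i3 : IntervalIntegrable (fun r => c * (meniscus κ c A r * r)) MeasureTheory.volume 0 1 :=
    Continuous.intervalIntegrable (by fun_prop) _ _
  have h := intervalIntegral.integral_eq_sub_of_hasDerivAt hd ((i1.sub i2).add i3)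
  rw [intervalIntegral.integral_add (i1.sub i2) i3, intervalIntegral.integral_sub i1 i2,
    intervalIntegral.integral_const_mul, hmean, h1] at h
  linarith

theorem integral_energy_meniscus_pos (hκ : 0 < κ) :
    0 < ∫ r in (0 : ℝ)..1, ((meniscus κ c A r) ^ 2 +
      (1 / κ ^ 2) * (deriv (meniscus κ c A) r) ^ 2) * r := by
  have hc := (contDiff_meniscus c A hκ).continuous
  have hs : Continuous (meniscusSlope κ A) := continuous_meniscusSlope A
  rw [deriv_meniscus c A hκ]
  refine intervalIntegral.integral_pos one_pos (Continuous.continuousOn (by fun_prop))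
    (fun r hr => mul_nonneg (by positivity) hr.1.le) ?_
  by_contra! hall
  have hzero : ∀ r ∈ Set.Ioo (0 : ℝ) 1, meniscus κ c A r = 0 ∧ meniscusSlope κ A r = 0 := by
    intro r hr
    have h := hall r ⟨hr.1.le, hr.2.le⟩
    have h' : (meniscus κ c A r) ^ 2 + (1 / κ ^ 2) * (meniscusSlope κ A r) ^ 2 ≤ 0 :=
      nonpos_of_mul_nonpos_left h hr.1
    have p1 := sq_nonneg (meniscus κ c A r)
    have p2 : 0 ≤ (1 / κ ^ 2) * (meniscusSlope κ A r) ^ 2 := by positivity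
    refine ⟨pow_eq_zero_iff two_ne_zero |>.1 (by linarith), ?_⟩
    have h0 : (1 / κ ^ 2) * (meniscusSlope κ A r) ^ 2 = 0 := by linarith
    simpa [hκ.ne'] using h0
  have hcr : ∀ r ∈ Set.Ioo (0 : ℝ) 1, r = c := by
    intro r hr
    have hev : (fun s => s * meniscusSlope κ A s) =ᶠ[nhds r] fun _ => 0 := by
      filter_upwards [isOpen_Ioo.mem_nhds hr] with s hs'
      rw [(hzero s hs').2, mul_zero]
    have hu := (hasDerivAt_mul_meniscusSlope c A hκ r).unique
      ((hasDerivAt_const r (0 : ℝ)).congr_of_eventuallyEq hev)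
    have hr0 := hr.1.ne'
    rw [(hzero r hr).1] at hu
    have : κ ^ 2 * r * (0 - r + c) = 0 := by linarith
    rcases mul_eq_zero.1 this with h | h
    · exact absurd h (by positivity)
    · linarith
  have a := hcr (1 / 2) (by norm_num)
  have b := hcr (1 / 3) (by norm_num)
  linarith

end meniscus

theorem isoperimetric_radial_m_zero (V B : ℝ) (hV : 0 < V) (hB : 0 < B)
    (κ : ℝ) (hκ : κ = Real.sqrt B)
    (Υ : ℝ) (hΥ : Υ = besselI 1 κ * struveL 0 κ - besselI 0 κ * struveL 1 κ)
    (d₀ : ℝ) (hd : d₀ = (3 * Real.pi * Υ + 2 * B * besselI 0 κ -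
      6 * Real.sqrt B * besselI 1 κ) / (3 * B * besselI 2 κ))
    (lam0 : ℝ)
    (hlam : lam0 = (18 * V / Real.pi) * (6 * d₀ - 3 +
      18 * (1 - d₀) * Real.pi * Υ / (B * besselI 0 κ) +
      3 * hyp2F3 (B / 4) -
      9 * Real.pi ^ 2 * struveL 0 κ * Υ / (B ^ ((3 : ℝ) / 2) * besselI 0 κ))⁻¹) :
    ∀ h : ℝ → ℝ, MemMV V h → (OmegaR0 B h) ^ 2 ≤ lam0 := by
  intro h hh
  have hκ0 : 0 < κ := hκ ▸ Real.sqrt_pos.2 hB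
  have hBκ : B = κ ^ 2 := by rw [hκ, Real.sq_sqrt hB.le]
  rw [← hκ] at hd
  have hB32 : B ^ ((3 : ℝ) / 2) = κ ^ 3 := by
    rw [hκ, Real.sqrt_eq_rpow, ← Real.rpow_natCast, ← Real.rpow_mul hB.le]
    norm_num
  rw [hB32] at hlam
  subst hBκ
  have hI0 := besselI_pos 0 hκ0
  have hI2 := besselI_pos 2 hκ0
  have hrec := two_mul_besselI_one_add κ
  have hd' : 3 * κ ^ 2 * besselI 2 κ * d₀ =
      3 * Real.pi * Υ + 2 * κ ^ 2 * besselI 0 κ - 6 * κ * besselI 1 κ := by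
    rw [hd]
    field_simp
  set A : ℝ := (d₀ - 1 + Real.pi / (2 * κ) * struveL 0 κ) / besselI 0 κ with hA
  have hAI : A * besselI 0 κ = d₀ - 1 + Real.pi / (2 * κ) * struveL 0 κ := by
    rw [hA]
    field_simp
  have h1 : meniscus κ d₀ A 1 = 0 := by
    rw [meniscus, mul_one, hAI]
    ring
  have hflux : 1 / 3 - d₀ / 2 - Real.pi / (2 * κ ^ 2) * struveL 1 κ + A * besselI 1 κ / κ = 0 := by
    have hI2' : besselI 2 κ = besselI 0 κ - 2 * besselI 1 κ / κ := by
      field_simp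
      linarith
    rw [hI2', hΥ] at hd'
    rw [hA]
    field_simp at hd' ⊢
    linear_combination -hd'
  have hmean := integral_meniscus_mul d₀ A hκ0
  rw [hflux] at hmean
  have hpos := integral_energy_meniscus_pos (c := d₀) (A := A) hκ0
  have hen := integral_energy_meniscus hκ0 h1 hmean
  have hmoment := integral_mul_meniscus_mul d₀ A hκ0
  rw [hen] at hpos
  set S := ∫ r in (0 : ℝ)..1, r * meniscus κ d₀ A r * r
  refine (sq_OmegaR0_le hV hB hpos hh (contDiff_meniscus d₀ A hκ0) h1 hmean rfl hen).trans
    (le_of_eq ?_)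
  have hX : 6 * d₀ - 3 + 18 * (1 - d₀) * Real.pi * Υ / (κ ^ 2 * besselI 0 κ) +
      3 * hyp2F3 (κ ^ 2 / 4) -
      9 * Real.pi ^ 2 * struveL 0 κ * Υ / (κ ^ 3 * besselI 0 κ) = 36 * S := by
    have e : 18 * (1 - d₀) * Real.pi * Υ / (κ ^ 2 * besselI 0 κ) -
        9 * Real.pi ^ 2 * struveL 0 κ * Υ / (κ ^ 3 * besselI 0 κ) =
        -(18 * A * Real.pi * Υ / κ ^ 2) := by
      rw [hA]
      field_simp
      ring
    rw [← hΥ] at hmoment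
    linear_combination e - 36 * hmoment - 36 * hflux
  rw [hlam, hX]
  have := Real.pi_pos
  field_simp
  norm_num
end

section
/- Fix V > 0 and for B > 0 define, with κ := √B, Υ(κ) := I₁(κ)L₀(κ) − I₀(κ)L₁(κ), d₀(B) := [3πΥ(κ) + 2B·I₀(κ) − 6√B·I₁(κ)]/(3B·I₂(κ)), λ*₀(B) := (18V/π)·[6d₀(B) − 3 + 18(1−d₀(B))πΥ(κ)/(B·I₀(κ)) + 3·₂F₃(1,2;3/2,5/2,3;B/4) − 9π²L₀(κ)Υ(κ)/(B^{3/2}·I₀(κ))]^{−1}, and h₀*(B;r) := (λ*₀(B)/3)[3d₀(B)r/2 − r²] + λ*₀(B)(1−d₀(B))·I₁(κr)/(κ·I₀(κ)) + (λ*₀(B)π/(2B))·[L₁(κr) − L₀(κ)·I₁(κr)/I₀(κ)]. Then λ*₀(B) → 18V/π as B → ∞, and for every r ∈ [0,1], h₀*(B;r) → (6V/π)(r − r²) as B → ∞. In particular, d₀(B) → 2/3 as B → ∞. -/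
/-- Upsilon(kappa) = I1(kappa) L0(kappa) - I0(kappa) L1(kappa). -/
noncomputable def UpsilonFn (κ : ℝ) : ℝ :=
  besselI 1 κ * struveL 0 κ - besselI 0 κ * struveL 1 κ

/-- The constant d0 appearing in the optimal radial container for m = 0. -/
noncomputable def dZero (B : ℝ) : ℝ :=
  (3 * Real.pi * UpsilonFn (Real.sqrt B) + 2 * B * besselI 0 (Real.sqrt B) -
    6 * Real.sqrt B * besselI 1 (Real.sqrt B)) / (3 * B * besselI 2 (Real.sqrt B))

/-- The squared maximal sloshing frequency lambda*0(B) for m = 0 with surface tension. -/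
noncomputable def lamStarR0 (V B : ℝ) : ℝ :=
  (18 * V / Real.pi) * (6 * dZero B - 3 +
    18 * (1 - dZero B) * Real.pi * UpsilonFn (Real.sqrt B) / (B * besselI 0 (Real.sqrt B)) +
    3 * hyp2F3 (B / 4) -
    9 * Real.pi ^ 2 * struveL 0 (Real.sqrt B) * UpsilonFn (Real.sqrt B) /
      (B ^ ((3 : ℝ) / 2) * besselI 0 (Real.sqrt B)))⁻¹

/-- The optimal radial container profile h0*(B; r) for m = 0 with surface tension. -/
noncomputable def hStarR0 (V B r : ℝ) : ℝ :=
  lamStarR0 V B / 3 * (3 * dZero B * r / 2 - r ^ 2) +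
    lamStarR0 V B * (1 - dZero B) * besselI 1 (Real.sqrt B * r) /
      (Real.sqrt B * besselI 0 (Real.sqrt B)) +
    lamStarR0 V B * Real.pi / (2 * B) *
      (struveL 1 (Real.sqrt B * r) -
        struveL 0 (Real.sqrt B) * besselI 1 (Real.sqrt B * r) / besselI 0 (Real.sqrt B))

section

open Real MeasureTheory intervalIntegral Filter Topology

theorem hasSum_integral_mul_powerSeries {c : ℕ → ℝ} {φ : ℕ → ℕ} {f g u : ℝ → ℝ}
    (hc : ∀ n, 0 ≤ c n) (hf : ∀ y, HasSum (fun n => c n * y ^ φ n) (f y))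
    (hg : Continuous g) (hu : Continuous u) (a b : ℝ) :
    HasSum (fun n => c n * ∫ t in a..b, g t * u t ^ φ n) (∫ t in a..b, g t * f (u t)) := by
  obtain ⟨K, hK⟩ := isCompact_uIcc.exists_bound_of_continuousOn (s := Set.uIcc a b) hg.continuousOn
  obtain ⟨R, hR⟩ := isCompact_uIcc.exists_bound_of_continuousOn (s := Set.uIcc a b) hu.continuousOn
  simp_rw [← intervalIntegral.integral_const_mul]
  refine intervalIntegral.hasSum_integral_of_dominated_convergence
    (fun n _ => K * (c n * R ^ φ n)) (fun n => ?_) (fun n => ?_) ?_ ?_ ?_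
  · exact Continuous.aestronglyMeasurable (by fun_prop)
  · refine ae_of_all _ fun t ht => ?_
    have ht' := Set.uIoc_subset_uIcc ht
    have h1 := hK t ht'
    have h2 := hR t ht'
    rw [norm_mul, norm_mul, norm_pow, Real.norm_of_nonneg (hc n), mul_left_comm]
    refine mul_le_mul h1 ?_ (mul_nonneg (hc n) (by positivity)) ((norm_nonneg _).trans h1)
    exact mul_le_mul_of_nonneg_left (pow_le_pow_left₀ (norm_nonneg _) h2 _) (hc n)
  · exact ae_of_all _ fun t _ => (hf R).summable.mul_left K
  · simp
  · refine ae_of_all _ fun t _ => ?_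
    simpa only [mul_left_comm] using (hf (u t)).mul_left (g t)

theorem hasDerivAt_integral_sin_pow_mul {f f' : ℝ → ℝ} (hf : ∀ y, HasDerivAt f (f' y) y)
    (hf' : Continuous f') (j : ℕ) (x : ℝ) :
    HasDerivAt (fun x => ∫ θ in (0 : ℝ)..π, sin θ ^ j * f (x * sin θ))
      (∫ θ in (0 : ℝ)..π, sin θ ^ (j + 1) * f' (x * sin θ)) x := by
  have hfc : Continuous f := continuous_iff_continuousAt.2 fun y => (hf y).continuousAt
  obtain ⟨M, hM⟩ := (isCompact_closedBall (0 : ℝ) (|x| + 1)).exists_bound_of_continuousOn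
    hf'.continuousOn
  refine (intervalIntegral.hasDerivAt_integral_of_dominated_loc_of_deriv_le
    (F := fun x θ => sin θ ^ j * f (x * sin θ))
    (F' := fun x θ => sin θ ^ (j + 1) * f' (x * sin θ)) (bound := fun _ => M)
    (Metric.ball_mem_nhds x one_pos) ?_ ?_ ?_ ?_ ?_ ?_).2
  · exact Eventually.of_forall fun y => Continuous.aestronglyMeasurable (by fun_prop)
  · exact Continuous.intervalIntegrable (by fun_prop) _ _
  · exact Continuous.aestronglyMeasurable (by fun_prop)
  · refine ae_of_all _ fun θ _ y hy => ?_
    have hy' : |y| ≤ |x| + 1 := by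
      have h1 : |y - x| < 1 := by simpa [Real.dist_eq] using hy
      have h2 := abs_sub_abs_le_abs_sub y x
      linarith
    have hs := abs_sin_le_one θ
    have h1 : ‖f' (y * sin θ)‖ ≤ M := hM _ (by
      rw [mem_closedBall_zero_iff, Real.norm_eq_abs, abs_mul]
      nlinarith [abs_nonneg y, abs_nonneg (sin θ)])
    have h2 : ‖sin θ ^ (j + 1)‖ ≤ 1 := by
      rw [norm_pow]
      exact pow_le_one₀ (norm_nonneg _) hs
    rw [norm_mul]
    nlinarith [norm_nonneg (f' (y * sin θ)), norm_nonneg (sin θ ^ (j + 1))]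
  · simp
  · refine ae_of_all _ fun θ _ y _ => ?_
    have h : HasDerivAt (fun x => f (x * sin θ)) (f' (y * sin θ) * sin θ) y := by
      simpa [Function.comp_def] using
        (hf (y * sin θ)).comp y ((hasDerivAt_id y).mul_const (sin θ))
    rw [pow_succ, mul_assoc, mul_comm (sin θ)]
    exact h.const_mul _

theorem integral_sin_pow_even_div_factorial (k : ℕ) :
    (∫ θ in (0 : ℝ)..π, sin θ ^ (2 * k)) / (2 * k).factorial =
      π * ((1 / 2) ^ (2 * k) / (k.factorial * Gamma (k + 1))) := by
  rw [Gamma_nat_eq_factorial]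
  induction k with
  | zero => simp
  | succ k ih =>
    have h : 2 * (k + 1) = 2 * k + 2 := by ring
    rw [h, integral_sin_pow]
    simp only [Nat.factorial_succ, sin_zero, sin_pi]
    rw [div_eq_iff (by positivity)] at ih
    rw [ih]
    push_cast
    field_simp
    simp
    ring

theorem Gamma_three_half_eq : Gamma (3 / 2) = √π / 2 := by
  rw [show (3 / 2 : ℝ) = 1 / 2 + 1 by norm_num, Gamma_add_one (by norm_num),
    Gamma_one_half_eq]
  ring

theorem integral_sin_pow_odd_div_factorial (k : ℕ) :
    (∫ θ in (0 : ℝ)..π, sin θ ^ (2 * k + 1)) / (2 * k + 1).factorial =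
      π * ((1 / 2) ^ (2 * k + 1) / (Gamma (k + 3 / 2) * Gamma (k + 3 / 2))) := by
  induction k with
  | zero =>
    have h := Gamma_three_half_eq
    have h2 := mul_self_sqrt pi_pos.le
    have h3 : π ≠ 0 := pi_ne_zero
    simp [h]
    rw [show √π / 2 * (√π / 2) = π / 4 by linear_combination h2 / 4]
    field_simp
    norm_num
  | succ k ih =>
    have h : 2 * (k + 1) + 1 = 2 * k + 1 + 2 := by ring
    have hG : Gamma (k + 3 / 2) ≠ 0 := (Gamma_pos_of_pos (by positivity)).ne'
    have hG' : Gamma ((k + 1 : ℕ) + 3 / 2) = (k + 3 / 2) * Gamma (k + 3 / 2) := by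
      rw [← Gamma_add_one (by positivity)]
      congr 1
      push_cast
      ring
    rw [h, integral_sin_pow, hG']
    simp only [Nat.factorial_succ, sin_zero, sin_pi]
    rw [div_eq_iff (by positivity)] at ih
    rw [ih]
    simp only [Nat.factorial_succ]
    push_cast
    field_simp
    simp
    ring

theorem besselI_zero_term (x : ℝ) (k : ℕ) :
    (x / 2) ^ (2 * k + 0) / ((k.factorial : ℝ) * Gamma (k + (0 : ℕ) + 1)) =
      1 / π * ((1 / (2 * k).factorial) * (x ^ (2 * k) * ∫ θ in (0 : ℝ)..π, sin θ ^ (2 * k))) := by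
  have h := integral_sin_pow_even_div_factorial k
  rw [div_eq_iff (by positivity)] at h
  rw [h]
  push_cast
  simp only [div_pow, one_pow, add_zero]
  field_simp

theorem besselI_one_term (x : ℝ) (k : ℕ) :
    (x / 2) ^ (2 * k + 1) / ((k.factorial : ℝ) * Gamma (k + (1 : ℕ) + 1)) =
      1 / π * ((1 / (2 * k + 1).factorial) *
        (x ^ (2 * k + 1) * ∫ θ in (0 : ℝ)..π, sin θ ^ (2 * k + 2))) := by
  have h := integral_sin_pow_even_div_factorial k
  have hG' : Gamma (k + (1 : ℕ) + 1) = (k + 1) * Gamma (k + 1) := by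
    rw [← Gamma_add_one (by positivity)]
    push_cast
    rfl
  have hG : Gamma (k + 1 : ℝ) ≠ 0 := (Gamma_pos_of_pos (by positivity)).ne'
  rw [div_eq_iff (by positivity)] at h
  rw [integral_sin_pow, h, hG', sin_zero, sin_pi]
  simp only [Nat.factorial_succ]
  push_cast
  simp only [div_pow, one_pow]
  field_simp
  simp
  ring

theorem struveL_zero_term (x : ℝ) (k : ℕ) :
    (x / 2) ^ (2 * k + 0 + 1) / (Gamma (k + 3 / 2) * Gamma (k + (0 : ℕ) + 3 / 2)) =
      1 / π * ((1 / (2 * k + 1).factorial) *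
        (x ^ (2 * k + 1) * ∫ θ in (0 : ℝ)..π, sin θ ^ (2 * k + 1))) := by
  have h := integral_sin_pow_odd_div_factorial k
  have hG : Gamma (k + 3 / 2 : ℝ) ≠ 0 := (Gamma_pos_of_pos (by positivity)).ne'
  rw [div_eq_iff (by positivity)] at h
  rw [h]
  push_cast
  simp only [div_pow, one_pow, add_zero]
  field_simp

theorem struveL_one_term (x : ℝ) (k : ℕ) :
    (x / 2) ^ (2 * k + 1 + 1) / (Gamma (k + 3 / 2) * Gamma (k + (1 : ℕ) + 3 / 2)) =
      1 / π * ((1 / (2 * k + 2).factorial) *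
        (x ^ (2 * k + 2) * ∫ θ in (0 : ℝ)..π, sin θ ^ (2 * k + 3))) := by
  have h := integral_sin_pow_odd_div_factorial k
  have hG : Gamma (k + 3 / 2 : ℝ) ≠ 0 := (Gamma_pos_of_pos (by positivity)).ne'
  have hG' : Gamma (k + (1 : ℕ) + 3 / 2) = (k + 3 / 2) * Gamma (k + 3 / 2) := by
    rw [← Gamma_add_one (by positivity)]
    congr 1
    push_cast
    ring
  rw [div_eq_iff (by positivity)] at h
  rw [show 2 * k + 3 = 2 * k + 1 + 2 by ring, integral_sin_pow, h, hG', sin_zero, sin_pi]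
  simp only [Nat.factorial_succ]
  push_cast
  simp only [div_pow, one_pow]
  field_simp
  simp
  ring

theorem hasSum_integral_sin_pow_mul {c : ℕ → ℝ} {φ : ℕ → ℕ} {f : ℝ → ℝ}
    (hc : ∀ n, 0 ≤ c n) (hf : ∀ y, HasSum (fun n => c n * y ^ φ n) (f y)) (j : ℕ) (x : ℝ) :
    HasSum (fun n => c n * (x ^ φ n * ∫ θ in (0 : ℝ)..π, sin θ ^ (φ n + j)))
      (∫ θ in (0 : ℝ)..π, sin θ ^ j * f (x * sin θ)) := by
  have h := hasSum_integral_mul_powerSeries hc hf (g := fun θ => sin θ ^ j)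
    (u := fun θ => x * sin θ) (by fun_prop) (by fun_prop) 0 π
  convert h using 3 with n
  rw [← intervalIntegral.integral_const_mul]
  congr 1 with θ
  ring

/-- The moment `∫ sin θ ^ j * cosh (x * sin θ)` over `[0, π]`. -/
noncomputable def sinCosh (j : ℕ) (x : ℝ) : ℝ :=
  ∫ θ in (0 : ℝ)..π, sin θ ^ j * cosh (x * sin θ)

/-- The moment `∫ sin θ ^ j * sinh (x * sin θ)` over `[0, π]`. -/
noncomputable def sinSinh (j : ℕ) (x : ℝ) : ℝ :=
  ∫ θ in (0 : ℝ)..π, sin θ ^ j * sinh (x * sin θ)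

theorem hasDerivAt_sinCosh (j : ℕ) (x : ℝ) :
    HasDerivAt (sinCosh j) (sinSinh (j + 1) x) x :=
  hasDerivAt_integral_sin_pow_mul hasDerivAt_cosh continuous_sinh j x

theorem hasDerivAt_sinSinh (j : ℕ) (x : ℝ) :
    HasDerivAt (sinSinh j) (sinCosh (j + 1) x) x :=
  hasDerivAt_integral_sin_pow_mul hasDerivAt_sinh continuous_cosh j x

theorem hasSum_cosh_mul (y : ℝ) :
    HasSum (fun n : ℕ => 1 / ((2 * n).factorial : ℝ) * y ^ (2 * n)) (cosh y) := by
  simpa only [one_div_mul_eq_div] using hasSum_cosh y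

theorem hasSum_sinh_mul (y : ℝ) :
    HasSum (fun n : ℕ => 1 / ((2 * n + 1).factorial : ℝ) * y ^ (2 * n + 1)) (sinh y) := by
  simpa only [one_div_mul_eq_div] using hasSum_sinh y

theorem hasSum_cosh_sub_one (y : ℝ) :
    HasSum (fun n : ℕ => 1 / ((2 * n + 2).factorial : ℝ) * y ^ (2 * n + 2)) (cosh y - 1) := by
  simpa [mul_add] using (hasSum_nat_add_iff' 1).2 (hasSum_cosh_mul y)

theorem hasSum_besselI_zero (x : ℝ) :
    HasSum (fun k : ℕ => (x / 2) ^ (2 * k + 0) / ((k.factorial : ℝ) * Gamma (k + (0 : ℕ) + 1)))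
      (1 / π * sinCosh 0 x) := by
  simp_rw [besselI_zero_term]
  exact (hasSum_integral_sin_pow_mul (fun n => by positivity) hasSum_cosh_mul 0 x).mul_left _

theorem besselI_zero_eq (x : ℝ) : besselI 0 x = 1 / π * sinCosh 0 x :=
  (hasSum_besselI_zero x).tsum_eq

theorem hasSum_besselI_one (x : ℝ) :
    HasSum (fun k : ℕ => (x / 2) ^ (2 * k + 1) / ((k.factorial : ℝ) * Gamma (k + (1 : ℕ) + 1)))
      (1 / π * sinSinh 1 x) := by
  simp_rw [besselI_one_term]
  exact (hasSum_integral_sin_pow_mul (fun n => by positivity) hasSum_sinh_mul 1 x).mul_left _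

theorem besselI_one_eq (x : ℝ) : besselI 1 x = 1 / π * sinSinh 1 x :=
  (hasSum_besselI_one x).tsum_eq

theorem struveL_zero_eq (x : ℝ) : struveL 0 x = 1 / π * sinSinh 0 x := by
  unfold struveL
  simp_rw [struveL_zero_term]
  exact ((hasSum_integral_sin_pow_mul (fun n => by positivity) hasSum_sinh_mul 0 x).mul_left
    _).tsum_eq

theorem hasSum_struveL_one (x : ℝ) :
    HasSum (fun k : ℕ => (x / 2) ^ (2 * k + 1 + 1) /
      (Gamma (k + 3 / 2) * Gamma (k + (1 : ℕ) + 3 / 2))) (1 / π * (sinCosh 1 x - 2)) := by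
  have h := (hasSum_integral_sin_pow_mul (fun n => by positivity) hasSum_cosh_sub_one 1 x).mul_left
    (1 / π)
  have h2 : ∫ θ in (0 : ℝ)..π, sin θ ^ 1 * (cosh (x * sin θ) - 1) = sinCosh 1 x - 2 := by
    simp_rw [mul_sub]
    rw [intervalIntegral.integral_sub (Continuous.intervalIntegrable (by fun_prop) _ _)
      (Continuous.intervalIntegrable (by fun_prop) _ _), sinCosh]
    norm_num
  rw [h2] at h
  simp_rw [struveL_one_term]
  exact h

theorem struveL_one_eq (x : ℝ) : struveL 1 x = 1 / π * (sinCosh 1 x - 2) :=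
  (hasSum_struveL_one x).tsum_eq

/-- The recurrence `I₂(x) = I₀(x) - (2 / x) I₁(x)`. -/
theorem besselI_two_eq {x : ℝ} (hx : x ≠ 0) :
    besselI 2 x = besselI 0 x - 2 / x * besselI 1 x := by
  have h0 := (hasSum_nat_add_iff' 1).2 (besselI_zero_eq x ▸ hasSum_besselI_zero x)
  have h1 := (hasSum_nat_add_iff' 1).2 ((besselI_one_eq x ▸ hasSum_besselI_one x).mul_left (2 / x))
  have hterm : ∀ k : ℕ, (x / 2) ^ (2 * k + 2) / ((k.factorial : ℝ) * Gamma (k + (2 : ℕ) + 1)) =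
      (x / 2) ^ (2 * (k + 1) + 0) / (((k + 1).factorial : ℝ) * Gamma ((k + 1 : ℕ) + (0 : ℕ) + 1)) -
      2 / x * ((x / 2) ^ (2 * (k + 1) + 1) /
        (((k + 1).factorial : ℝ) * Gamma ((k + 1 : ℕ) + (1 : ℕ) + 1))) := by
    intro k
    rw [← Nat.cast_add, ← Nat.cast_add, ← Nat.cast_add, Gamma_nat_eq_factorial,
      Gamma_nat_eq_factorial]
    simp only [Nat.factorial_succ, add_zero]
    push_cast
    field_simp
    ring
  unfold besselI
  simp_rw [hterm]
  refine (h0.sub h1).tsum_eq.trans ?_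
  have h2 : Gamma (1 + 1) = 1 := by rw [Gamma_add_one one_ne_zero]; simp
  simp [h2, besselI]
  field_simp
  ring

theorem besselI_one_parts (x : ℝ) :
    sinSinh 1 x + x * sinCosh 2 x = x * sinCosh 0 x := by
  have h : ∫ θ in (0 : ℝ)..π, (sin θ * sinh (x * sin θ) - cos θ * (cosh (x * sin θ) * (x * cos θ)))
      = -cos π * sinh (x * sin π) - -cos 0 * sinh (x * sin 0) := by
    refine intervalIntegral.integral_eq_sub_of_hasDerivAt (f := fun θ => -cos θ * sinh (x * sin θ))
      (fun θ _ => ?_) (Continuous.intervalIntegrable (by fun_prop) _ _)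
    exact ((hasDerivAt_cos θ).neg.mul ((hasDerivAt_sin θ).const_mul x).sinh).congr_deriv
      (by simp only [Pi.neg_apply]; ring)
  have h2 : ∫ θ in (0 : ℝ)..π,
      (sin θ * sinh (x * sin θ) - cos θ * (cosh (x * sin θ) * (x * cos θ))) =
      sinSinh 1 x + x * sinCosh 2 x - x * sinCosh 0 x := by
    unfold sinSinh sinCosh
    rw [← intervalIntegral.integral_const_mul, ← intervalIntegral.integral_const_mul,
      ← intervalIntegral.integral_add, ← intervalIntegral.integral_sub]
    · congr 1 with θ
      linear_combination -(x * cosh (x * sin θ)) * sin_sq_add_cos_sq θ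
    all_goals exact Continuous.intervalIntegrable (by fun_prop) _ _
  rw [h] at h2
  simp at h2
  linarith

theorem struveL_one_parts (x : ℝ) :
    sinCosh 1 x + x * sinSinh 2 x = 2 + x * sinSinh 0 x := by
  have h : ∫ θ in (0 : ℝ)..π, (sin θ * cosh (x * sin θ) - cos θ * (sinh (x * sin θ) * (x * cos θ)))
      = -cos π * cosh (x * sin π) - -cos 0 * cosh (x * sin 0) := by
    refine intervalIntegral.integral_eq_sub_of_hasDerivAt (f := fun θ => -cos θ * cosh (x * sin θ))
      (fun θ _ => ?_) (Continuous.intervalIntegrable (by fun_prop) _ _)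
    exact ((hasDerivAt_cos θ).neg.mul ((hasDerivAt_sin θ).const_mul x).cosh).congr_deriv
      (by simp only [Pi.neg_apply]; ring)
  have h2 : ∫ θ in (0 : ℝ)..π,
      (sin θ * cosh (x * sin θ) - cos θ * (sinh (x * sin θ) * (x * cos θ))) =
      sinCosh 1 x + x * sinSinh 2 x - x * sinSinh 0 x := by
    unfold sinSinh sinCosh
    rw [← intervalIntegral.integral_const_mul, ← intervalIntegral.integral_const_mul,
      ← intervalIntegral.integral_add, ← intervalIntegral.integral_sub]
    · congr 1 with θ
      linear_combination -(x * sinh (x * sin θ)) * sin_sq_add_cos_sq θ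
    all_goals exact Continuous.intervalIntegrable (by fun_prop) _ _
  rw [h] at h2
  simp at h2
  linarith

theorem hasDerivAt_mul_upsilonFn (x : ℝ) :
    HasDerivAt (fun x => π * x / 2 * UpsilonFn x) (x * besselI 1 x) x := by
  have hS1 := hasDerivAt_sinSinh 1 x
  have hS0 := hasDerivAt_sinSinh 0 x
  have hC1 := hasDerivAt_sinCosh 1 x
  have hC0 := hasDerivAt_sinCosh 0 x
  have h := (((hasDerivAt_id x).const_mul (1 / (2 * π))).mul
    ((hS1.mul hS0).sub (hC0.mul (hC1.sub_const 2))))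
  have hpi := pi_ne_zero
  have hfun : (fun x => π * x / 2 * UpsilonFn x) =
      (fun y => 1 / (2 * π) * id y) *
        (sinSinh 1 * sinSinh 0 - sinCosh 0 * fun x => sinCosh 1 x - 2) := by
    ext y
    simp only [UpsilonFn, besselI_one_eq, besselI_zero_eq, struveL_one_eq, struveL_zero_eq,
      Pi.mul_apply, Pi.sub_apply, id]
    field_simp
  rw [hfun]
  refine h.congr_deriv ?_
  rw [besselI_one_eq]
  simp only [Pi.mul_apply, Pi.sub_apply, id]
  have e1 := besselI_one_parts x
  have e2 := struveL_one_parts x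
  simp only [zero_add, one_add_one_eq_two]
  field_simp
  linear_combination sinSinh 0 x * e1 - sinCosh 0 x * e2

theorem continuous_besselI_one : Continuous (besselI 1) := by
  rw [funext besselI_one_eq]
  exact continuous_const.mul
    (continuous_iff_continuousAt.2 fun y => (hasDerivAt_sinSinh 1 y).continuousAt)

theorem integral_mul_besselI_one (x : ℝ) :
    ∫ t in (0 : ℝ)..x, t * besselI 1 t = π * x / 2 * UpsilonFn x := by
  have hc := continuous_besselI_one
  rw [intervalIntegral.integral_eq_sub_of_hasDerivAt (fun t _ => hasDerivAt_mul_upsilonFn t)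
    ((continuous_id.mul hc).intervalIntegrable _ _)]
  simp

theorem continuous_struveL_one : Continuous (struveL 1) := by
  rw [funext struveL_one_eq]
  exact continuous_const.mul ((continuous_iff_continuousAt.2
    fun y => (hasDerivAt_sinCosh 1 y).continuousAt).sub continuous_const)

theorem sinCosh_sub_sinSinh (j : ℕ) (x : ℝ) :
    sinCosh j x - sinSinh j x = ∫ θ in (0 : ℝ)..π, sin θ ^ j * exp (-(x * sin θ)) := by
  unfold sinCosh sinSinh
  rw [← intervalIntegral.integral_sub (Continuous.intervalIntegrable (by fun_prop) _ _)
    (Continuous.intervalIntegrable (by fun_prop) _ _)]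
  simp_rw [← mul_sub, cosh_sub_sinh]

theorem sinCosh_sub_sinSinh_nonneg (j : ℕ) (x : ℝ) : 0 ≤ sinCosh j x - sinSinh j x := by
  rw [sinCosh_sub_sinSinh]
  refine intervalIntegral.integral_nonneg pi_pos.le fun θ hθ => ?_
  have := sin_nonneg_of_mem_Icc hθ
  positivity

theorem sinCosh_sub_sinSinh_le (j : ℕ) {x : ℝ} (hx : 0 ≤ x) :
    sinCosh j x - sinSinh j x ≤ ∫ θ in (0 : ℝ)..π, sin θ ^ j := by
  rw [sinCosh_sub_sinSinh]
  refine intervalIntegral.integral_mono_on pi_pos.le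
    (Continuous.intervalIntegrable (by fun_prop) _ _)
    (Continuous.intervalIntegrable (by fun_prop) _ _) fun θ hθ => ?_
  have h := sin_nonneg_of_mem_Icc hθ
  refine mul_le_of_le_one_right (by positivity) (exp_le_one_iff.2 ?_)
  have := mul_nonneg hx h
  linarith

theorem besselI_zero_sub_struveL_zero_mem {x : ℝ} (hx : 0 ≤ x) :
    besselI 0 x - struveL 0 x ∈ Set.Icc (0 : ℝ) 1 := by
  have h1 := sinCosh_sub_sinSinh_nonneg 0 x
  have h2 := sinCosh_sub_sinSinh_le 0 hx
  have hpi := pi_pos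
  simp only [pow_zero, intervalIntegral.integral_const, sub_zero, smul_eq_mul, mul_one] at h2
  rw [besselI_zero_eq, struveL_zero_eq, ← mul_sub, one_div_mul_eq_div]
  exact ⟨by positivity, (div_le_one hpi).2 h2⟩

theorem besselI_one_sub_struveL_one_mem {x : ℝ} (hx : 0 ≤ x) :
    besselI 1 x - struveL 1 x ∈ Set.Icc (0 : ℝ) 1 := by
  have h1 := sinCosh_sub_sinSinh_nonneg 1 x
  have h2 := sinCosh_sub_sinSinh_le 1 hx
  have hpi := pi_gt_three
  simp only [pow_one, integral_sin, cos_zero, cos_pi] at h2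
  rw [besselI_one_eq, struveL_one_eq, ← mul_sub, one_div_mul_eq_div]
  exact ⟨div_nonneg (by linarith) (by linarith), (div_le_one (by linarith)).2 (by linarith)⟩

theorem one_le_besselI_zero (x : ℝ) : 1 ≤ besselI 0 x := by
  rw [besselI_zero_eq, one_div_mul_eq_div, one_le_div pi_pos]
  have h : ∫ θ in (0 : ℝ)..π, (1 : ℝ) ≤ sinCosh 0 x :=
    intervalIntegral.integral_mono_on pi_pos.le
      (Continuous.intervalIntegrable (by fun_prop) _ _)
      (Continuous.intervalIntegrable (by fun_prop) _ _) fun θ _ => by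
        simp
  simpa using h

theorem besselI_one_nonneg {x : ℝ} (hx : 0 ≤ x) : 0 ≤ besselI 1 x := by
  rw [besselI_one_eq]
  refine mul_nonneg (by positivity) (intervalIntegral.integral_nonneg pi_pos.le fun θ hθ => ?_)
  have h := sin_nonneg_of_mem_Icc hθ
  exact mul_nonneg (by positivity) (sinh_nonneg_iff.2 (mul_nonneg hx h))

theorem besselI_one_le_besselI_zero {x y : ℝ} (hy : 0 ≤ y) (hyx : y ≤ x) :
    besselI 1 y ≤ besselI 0 x := by
  rw [besselI_one_eq, besselI_zero_eq]
  refine mul_le_mul_of_nonneg_left ?_ (by positivity)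
  refine intervalIntegral.integral_mono_on pi_pos.le
    (Continuous.intervalIntegrable (by fun_prop) _ _)
    (Continuous.intervalIntegrable (by fun_prop) _ _) fun θ hθ => ?_
  have h := sin_nonneg_of_mem_Icc hθ
  have hys := mul_nonneg hy h
  have h1 : sinh (y * sin θ) ≤ cosh (y * sin θ) := (sinh_lt_cosh _).le
  have h2 : cosh (y * sin θ) ≤ cosh (x * sin θ) := by
    rw [cosh_le_cosh, abs_of_nonneg hys, abs_of_nonneg (mul_nonneg (hy.trans hyx) h)]
    gcongr
  have h3 : 0 ≤ sinh (y * sin θ) := sinh_nonneg_iff.2 hys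
  rw [pow_one, pow_zero, one_mul]
  exact (mul_le_of_le_one_left h3 (sin_le_one θ)).trans (h1.trans h2)

theorem abs_upsilonFn_le {x : ℝ} (hx : 0 ≤ x) : |UpsilonFn x| ≤ besselI 0 x := by
  obtain ⟨h1, h2⟩ := besselI_zero_sub_struveL_zero_mem hx
  obtain ⟨h3, h4⟩ := besselI_one_sub_struveL_one_mem hx
  have h5 := one_le_besselI_zero x
  have h6 := besselI_one_nonneg hx
  have h7 := besselI_one_le_besselI_zero hx le_rfl
  have h : UpsilonFn x = besselI 0 x * (besselI 1 x - struveL 1 x) -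
      besselI 1 x * (besselI 0 x - struveL 0 x) := by
    unfold UpsilonFn
    ring
  rw [h, abs_le]
  constructor <;> nlinarith [mul_nonneg h6 h1, mul_nonneg (zero_le_one.trans h5) h3]

theorem risingFactorial_mul_Gamma {a : ℝ} (ha : 0 < a) (k : ℕ) :
    risingFactorial a k * Gamma a = Gamma (k + a) := by
  induction k with
  | zero => simp [risingFactorial]
  | succ k ih =>
    have h : ((k + 1 : ℕ) : ℝ) + a = (k + a) + 1 := by push_cast; ring
    rw [h, Gamma_add_one (by positivity), ← ih, risingFactorial, Finset.prod_range_succ,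
      ← risingFactorial]
    ring

theorem hyp2F3_term (x : ℝ) (k : ℕ) :
    risingFactorial 1 k * risingFactorial 2 k /
      (risingFactorial (3 / 2) k * risingFactorial (5 / 2) k * risingFactorial 3 k) *
      (x ^ 2 / 4) ^ k / (k.factorial : ℝ) * x ^ 4 =
    6 * π * (1 / (2 ^ (2 * k + 2) * (Gamma (k + 3 / 2) * Gamma (k + (1 : ℕ) + 3 / 2))) *
      ∫ t in (0 : ℝ)..x, t * t ^ (2 * k + 2)) := by
  have e1 := risingFactorial_mul_Gamma one_pos k
  have e2 := risingFactorial_mul_Gamma two_pos k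
  have e3 := risingFactorial_mul_Gamma three_pos k
  have e4 := risingFactorial_mul_Gamma (show (0 : ℝ) < 3 / 2 by norm_num) k
  have e5 := risingFactorial_mul_Gamma (show (0 : ℝ) < 5 / 2 by norm_num) k
  have g3 := Gamma_three_half_eq
  have g5 : Gamma (5 / 2) = 3 / 2 * (√π / 2) := by
    rw [← g3, ← Gamma_add_one (by norm_num)]
    norm_num
  have n4 : Gamma (k + 3 / 2) ≠ 0 := (Gamma_pos_of_pos (by positivity)).ne'
  have n5 : Gamma (k + 5 / 2) ≠ 0 := (Gamma_pos_of_pos (by positivity)).ne'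
  have k2 : Gamma (k + 2) = (k + 1) * k.factorial := by
    rw [show (k : ℝ) + 2 = (k + 1 : ℕ) + 1 by push_cast; ring, Gamma_nat_eq_factorial,
      Nat.factorial_succ]
    push_cast
    rfl
  have k3 : Gamma (k + 3) = (k + 2) * ((k + 1) * k.factorial) := by
    rw [← k2, ← Gamma_add_one (by positivity)]
    congr 1
    ring
  have c2 : Gamma (2 : ℝ) = 1 := Gamma_two
  have c3 : Gamma (3 : ℝ) = 2 := by
    rw [show (3 : ℝ) = 2 + 1 by norm_num, Gamma_add_one two_ne_zero, c2, mul_one]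
  have s0 : 0 < √π := sqrt_pos.2 pi_pos
  have s2 : √π ^ 2 = π := sq_sqrt pi_pos.le
  rw [Gamma_one, mul_one, Gamma_nat_eq_factorial] at e1
  rw [c2, mul_one, k2] at e2
  rw [c3, k3, ← eq_div_iff two_ne_zero] at e3
  rw [g3, ← eq_div_iff (by positivity)] at e4
  rw [g5, ← eq_div_iff (by positivity)] at e5
  have h5 : (k : ℝ) + (1 : ℕ) + 3 / 2 = k + 5 / 2 := by push_cast; ring
  have hint : ∫ t in (0 : ℝ)..x, t * t ^ (2 * k + 2) = x ^ (2 * k + 4) / (2 * k + 4) := by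
    simp_rw [← pow_succ']
    rw [integral_pow]
    push_cast
    simp
    ring
  rw [e1, e2, e3, e4, e5, h5, hint, div_pow, ← pow_mul,
    show (4 : ℝ) ^ k = 2 ^ (2 * k) by rw [pow_mul]; norm_num]
  field_simp
  rw [s2]
  ring

theorem hyp2F3_mul_pow_four (x : ℝ) :
    hyp2F3 (x ^ 2 / 4) * x ^ 4 = 6 * π * ∫ t in (0 : ℝ)..x, t * struveL 1 t := by
  have h := hasSum_integral_mul_powerSeries
    (c := fun k : ℕ => 1 / (2 ^ (2 * k + 2) * (Gamma (k + 3 / 2) * Gamma (k + (1 : ℕ) + 3 / 2))))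
    (φ := fun k => 2 * k + 2) (f := struveL 1) (fun k => ?_) (fun y => ?_) continuous_id
    continuous_id 0 x
  · unfold hyp2F3
    rw [← tsum_mul_right]
    simp_rw [hyp2F3_term]
    exact (h.mul_left (6 * π)).tsum_eq
  · have h4 : 0 < Gamma (k + 3 / 2) := Gamma_pos_of_pos (by positivity)
    have h5 : 0 < Gamma (k + (1 : ℕ) + 3 / 2) := Gamma_pos_of_pos (by positivity)
    positivity
  · rw [struveL_one_eq]
    convert hasSum_struveL_one y using 2 with k
    rw [div_pow]
    field_simp

/-- The exponentially growing parts of the hypergeometric term and of its Bessel–Struve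
counterpart cancel, with a remainder of order `x⁻²`. -/
theorem abs_hyp2F3_sub_le {x : ℝ} (hx : 0 < x) :
    |3 * hyp2F3 (x ^ 2 / 4) -
      9 * π ^ 2 * struveL 0 x * UpsilonFn x / (x ^ 3 * besselI 0 x)| ≤
      9 * π / x ^ 2 + 9 * π ^ 2 / x ^ 3 := by
  have hI := one_le_besselI_zero x
  have hI0 : 0 < besselI 0 x := one_pos.trans_le hI
  obtain ⟨m1, m2⟩ := besselI_zero_sub_struveL_zero_mem hx.le
  have hU := abs_upsilonFn_le hx.le
  have hpi := pi_pos
  have hcI := continuous_besselI_one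
  have hcL := continuous_struveL_one
  set D := ∫ t in (0 : ℝ)..x, t * (besselI 1 t - struveL 1 t) with hD
  have hDeq : D = π * x / 2 * UpsilonFn x - ∫ t in (0 : ℝ)..x, t * struveL 1 t := by
    rw [← integral_mul_besselI_one, hD, ← intervalIntegral.integral_sub]
    · simp_rw [mul_sub]
    all_goals exact Continuous.intervalIntegrable (by fun_prop) _ _
  have hD0 : 0 ≤ D := intervalIntegral.integral_nonneg hx.le fun t ht =>
    mul_nonneg ht.1 (besselI_one_sub_struveL_one_mem ht.1).1
  have hD1 : D ≤ x ^ 2 / 2 := by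
    have h : D ≤ ∫ t in (0 : ℝ)..x, t :=
      intervalIntegral.integral_mono_on hx.le
        (Continuous.intervalIntegrable (by fun_prop) _ _)
        (Continuous.intervalIntegrable (by fun_prop) _ _) fun t ht =>
          mul_le_of_le_one_right ht.1 (besselI_one_sub_struveL_one_mem ht.1).2
    simpa using h
  have hF : hyp2F3 (x ^ 2 / 4) = 6 * π * (π * x / 2 * UpsilonFn x - D) / x ^ 4 := by
    rw [eq_div_iff (by positivity), hyp2F3_mul_pow_four, hDeq]
    ring
  have key : 3 * hyp2F3 (x ^ 2 / 4) -
      9 * π ^ 2 * struveL 0 x * UpsilonFn x / (x ^ 3 * besselI 0 x) =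
      9 * π ^ 2 / x ^ 3 * ((besselI 0 x - struveL 0 x) * (UpsilonFn x / besselI 0 x)) -
        18 * π / x ^ 4 * D := by
    rw [hF]
    field_simp
    ring
  have hb1 : |(besselI 0 x - struveL 0 x) * (UpsilonFn x / besselI 0 x)| ≤ 1 := by
    rw [abs_mul, abs_div, abs_of_pos hI0, abs_of_nonneg m1]
    exact mul_le_one₀ m2 (by positivity) ((div_le_one hI0).2 hU)
  have hb2 : 18 * π / x ^ 4 * D ≤ 9 * π / x ^ 2 := by
    calc 18 * π / x ^ 4 * D ≤ 18 * π / x ^ 4 * (x ^ 2 / 2) := by gcongr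
      _ = 9 * π / x ^ 2 := by field_simp; ring
  have hb3 : 0 ≤ 18 * π / x ^ 4 * D := by positivity
  rw [key]
  refine (abs_sub _ _).trans ?_
  rw [abs_mul, abs_of_nonneg hb3, abs_of_pos (by positivity : 0 < 9 * π ^ 2 / x ^ 3)]
  have : 9 * π ^ 2 / x ^ 3 * |(besselI 0 x - struveL 0 x) * (UpsilonFn x / besselI 0 x)| ≤
      9 * π ^ 2 / x ^ 3 := mul_le_of_le_one_right (by positivity) hb1
  linarith

theorem tendsto_mul_of_abs_le_one {f g : ℝ → ℝ} (hf : Tendsto f atTop (𝓝 0))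
    (hg : ∀ B, |g B| ≤ 1) : Tendsto (fun B => f B * g B) atTop (𝓝 0) := by
  refine squeeze_zero_norm (fun B => ?_) (tendsto_zero_iff_norm_tendsto_zero.1 hf)
  rw [norm_mul]
  exact mul_le_of_le_one_right (norm_nonneg _) (hg B)

theorem tendsto_one_div_sqrt : Tendsto (fun B : ℝ => 1 / √B) atTop (𝓝 0) := by
  simpa only [one_div, Function.comp_def] using tendsto_inv_atTop_zero.comp tendsto_sqrt_atTop

theorem tendsto_one_div_self : Tendsto (fun B : ℝ => 1 / B) atTop (𝓝 0) := by
  simpa only [one_div] using tendsto_inv_atTop_zero (𝕜 := ℝ)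

theorem abs_upsilonFn_div_le {x : ℝ} (hx : 0 ≤ x) : |UpsilonFn x / besselI 0 x| ≤ 1 := by
  have h := one_pos.trans_le (one_le_besselI_zero x)
  rw [abs_div, abs_of_pos h]
  exact (div_le_one h).2 (abs_upsilonFn_le hx)

theorem besselI_one_div_mem {x y : ℝ} (hy : 0 ≤ y) (hyx : y ≤ x) :
    besselI 1 y / besselI 0 x ∈ Set.Icc (0 : ℝ) 1 := by
  have h := one_pos.trans_le (one_le_besselI_zero x)
  exact ⟨div_nonneg (besselI_one_nonneg hy) h.le,
    (div_le_one h).2 (besselI_one_le_besselI_zero hy hyx)⟩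

theorem abs_le_one_of_mem_Icc {a : ℝ} (ha : a ∈ Set.Icc (0 : ℝ) 1) : |a| ≤ 1 :=
  abs_le.2 ⟨by linarith [ha.1], ha.2⟩

theorem tendsto_dZero : Tendsto dZero atTop (𝓝 (2 / 3)) := by
  have ha := tendsto_mul_of_abs_le_one tendsto_one_div_self
    (fun B => abs_upsilonFn_div_le (sqrt_nonneg B))
  have hb := tendsto_mul_of_abs_le_one tendsto_one_div_sqrt
    (fun B => abs_le_one_of_mem_Icc (besselI_one_div_mem (sqrt_nonneg B) le_rfl))
  have h := (((ha.const_mul (3 * π)).add_const 2).sub (hb.const_mul 6)).div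
    (((hb.const_mul 2).const_sub 1).const_mul 3) (by norm_num)
  have hval : (3 * π * 0 + 2 - 6 * 0) / (3 * (1 - 2 * 0)) = 2 / 3 := by norm_num
  rw [hval] at h
  refine h.congr' ?_
  filter_upwards [eventually_gt_atTop 0] with B hB
  have hκ := sqrt_pos.2 hB
  have hI := one_pos.trans_le (one_le_besselI_zero √B)
  have hBκ : B = √B ^ 2 := (sq_sqrt hB.le).symm
  simp only [Pi.div_apply, dZero]
  rw [besselI_two_eq hκ.ne']
  generalize √B = κ at *
  subst hBκ
  rw [show 3 * (1 - 2 * (1 / κ * (besselI 1 κ / besselI 0 κ))) =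
    3 * κ ^ 2 * (besselI 0 κ - 2 / κ * besselI 1 κ) / (κ ^ 2 * besselI 0 κ) by field_simp,
    div_div_eq_mul_div]
  congr 1
  field_simp

theorem tendsto_lamStarR0 (V : ℝ) : Tendsto (lamStarR0 V) atTop (𝓝 (18 * V / π)) := by
  have ha := tendsto_mul_of_abs_le_one tendsto_one_div_self
    (fun B => abs_upsilonFn_div_le (sqrt_nonneg B))
  have hR : Tendsto (fun B => 3 * hyp2F3 (√B ^ 2 / 4) -
      9 * π ^ 2 * struveL 0 √B * UpsilonFn √B / (√B ^ 3 * besselI 0 √B)) atTop (𝓝 0) := by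
    refine squeeze_zero_norm' ?_ (a := fun B => 9 * π * (1 / √B) ^ 2 + 9 * π ^ 2 * (1 / √B) ^ 3) ?_
    · filter_upwards [eventually_gt_atTop 0] with B hB
      refine (abs_hyp2F3_sub_le (sqrt_pos.2 hB)).trans_eq ?_
      simp only [div_pow, one_pow, mul_one_div]
    · have h := tendsto_one_div_sqrt
      simpa using ((h.pow 2).const_mul (9 * π)).add ((h.pow 3).const_mul (9 * π ^ 2))
  have h := ((((tendsto_dZero.const_mul 6).sub_const 3).add
    (((tendsto_dZero.const_sub 1).const_mul (18 * π)).mul ha)).add hR).inv₀ (by norm_num)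
  have h' := h.const_mul (18 * V / π)
  have hval : 18 * V / π * (6 * (2 / 3) - 3 + 18 * π * (1 - 2 / 3) * 0 + 0)⁻¹ = 18 * V / π := by
    norm_num
  rw [hval] at h'
  refine h'.congr' ?_
  filter_upwards [eventually_gt_atTop 0] with B hB
  have hI := one_pos.trans_le (one_le_besselI_zero √B)
  have hpow : B ^ ((3 : ℝ) / 2) = √B ^ 3 := by
    rw [sqrt_eq_rpow, ← rpow_natCast, ← rpow_mul hB.le]
    norm_num
  rw [lamStarR0, hpow, sq_sqrt hB.le]
  congr 2
  field_simp
  ring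

theorem tendsto_hStarR0 (V : ℝ) {r : ℝ} (hr : r ∈ Set.Icc (0 : ℝ) 1) :
    Tendsto (fun B => hStarR0 V B r) atTop (𝓝 (6 * V / π * (r - r ^ 2))) := by
  have hl := tendsto_lamStarR0 V
  have hd := tendsto_dZero
  have hc : ∀ B, besselI 1 (√B * r) / besselI 0 √B ∈ Set.Icc (0 : ℝ) 1 := fun B =>
    besselI_one_div_mem (mul_nonneg (sqrt_nonneg B) hr.1)
      (mul_le_of_le_one_right (sqrt_nonneg B) hr.2)
  have h1 := tendsto_mul_of_abs_le_one tendsto_one_div_sqrt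
    (fun B => abs_le_one_of_mem_Icc (hc B))
  have h2 := tendsto_mul_of_abs_le_one
    (g := fun B => (besselI 0 √B - struveL 0 √B) * (besselI 1 (√B * r) / besselI 0 √B) -
      (besselI 1 (√B * r) - struveL 1 (√B * r))) tendsto_one_div_self (fun B => by
    obtain ⟨c1, c2⟩ := hc B
    obtain ⟨m1, m2⟩ := besselI_zero_sub_struveL_zero_mem (sqrt_nonneg B)
    obtain ⟨n1, n2⟩ := besselI_one_sub_struveL_one_mem (mul_nonneg (sqrt_nonneg B) hr.1)
    have p1 := mul_nonneg m1 c1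
    have p2 := mul_le_one₀ m2 c1 c2
    exact abs_le.2 ⟨by linarith, by linarith⟩)
  have h := (((hl.div_const 3).mul ((((hd.const_mul 3).mul_const r).div_const 2).sub_const
    (r ^ 2))).add ((hl.mul (hd.const_sub 1)).mul h1)).add ((hl.mul_const (π / 2)).mul h2)
  have hval : 18 * V / π / 3 * (3 * (2 / 3) * r / 2 - r ^ 2) + 18 * V / π * (1 - 2 / 3) * 0 +
      18 * V / π * (π / 2) * 0 = 6 * V / π * (r - r ^ 2) := by
    ring
  rw [hval] at h
  refine h.congr' ?_
  filter_upwards [eventually_gt_atTop 0] with B hB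
  have hI := one_pos.trans_le (one_le_besselI_zero √B)
  have hκ := sqrt_pos.2 hB
  rw [hStarR0]
  congr 1
  · congr 1
    field_simp
  · field_simp
    ring

end

theorem radial_m_zero_zero_surface_tension_limit (V : ℝ) (hV : 0 < V) :
    Filter.Tendsto (lamStarR0 V) Filter.atTop (nhds (18 * V / Real.pi)) ∧
    (∀ r ∈ Set.Icc (0 : ℝ) 1,
      Filter.Tendsto (fun B => hStarR0 V B r) Filter.atTop
        (nhds (6 * V / Real.pi * (r - r ^ 2)))) ∧
    Filter.Tendsto dZero Filter.atTop (nhds (2 / 3)) := by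
  exact ⟨tendsto_lamStarR0 V, fun r hr => tendsto_hStarR0 V hr, tendsto_dZero⟩
end

section
/- Let I₀ denote the modified Bessel function of the first kind of order 0. Then ∫_0^κ I₀(s) ds ~ e^κ/√(2πκ) as κ → ∞; that is, lim_{κ→∞} √(2πκ)·e^{−κ}·∫_0^κ I₀(s) ds = 1. -/
open Real MeasureTheory Filter Topology Set

theorem besselI_zero_eq_integral (x : ℝ) :
    besselI 0 x = π⁻¹ * ∫ θ in (-(π / 2))..(π / 2), cosh (x * cos θ) := by
  have hshift : ∫ θ in (-(π / 2))..(π / 2), cosh (x * cos θ)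
      = ∫ θ in (0 : ℝ)..π, cosh (x * sin θ) := by
    have h := intervalIntegral.integral_comp_add_right (a := -(π / 2)) (b := π / 2)
      (fun θ => cosh (x * sin θ)) (π / 2)
    simp only [sin_add_pi_div_two, neg_add_cancel, add_halves] at h
    exact h
  have hprod (n : ℕ) : ∏ i ∈ Finset.range n, ((2 * (i : ℝ) + 1) / (2 * i + 2))
      = (2 * n).factorial / (4 ^ n * n.factorial ^ 2) := by
    induction n with
    | zero => simp
    | succ n ih =>
      rw [Finset.prod_range_succ, ih, show 2 * (n + 1) = 2 * n + 1 + 1 by ring]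
      simp only [Nat.factorial_succ]
      push_cast
      have := n.factorial_ne_zero
      field_simp
      ring
  have hsum := intervalIntegral.hasSum_integral_of_dominated_convergence (μ := volume)
    (a := 0) (b := π) (F := fun (n : ℕ) θ => (x * sin θ) ^ (2 * n) / (2 * n).factorial)
    (f := fun θ => cosh (x * sin θ)) (fun n _ => x ^ (2 * n) / (2 * n).factorial)
    (fun n => (by fun_prop : Continuous fun θ => (x * sin θ) ^ (2 * n) / _).aestronglyMeasurable)
    (fun n => Eventually.of_forall fun θ _ => by
      rw [norm_div, norm_of_nonneg (Nat.cast_nonneg _), norm_of_nonneg (by rw [pow_mul]; positivity),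
        pow_mul, pow_mul x]
      refine div_le_div_of_nonneg_right (pow_le_pow_left₀ (sq_nonneg _) ?_ n) (Nat.cast_nonneg _)
      rw [mul_pow]
      exact mul_le_of_le_one_right (sq_nonneg x) (sin_sq_le_one θ))
    (Eventually.of_forall fun _ _ => (hasSum_cosh x).summable)
    (by simp)
    (Eventually.of_forall fun θ _ => hasSum_cosh _)
  rw [hshift, ← hsum.tsum_eq, ← tsum_mul_left, besselI]
  refine tsum_congr fun n => ?_
  simp only [mul_pow]
  rw [intervalIntegral.integral_div, intervalIntegral.integral_const_mul, integral_sin_pow_even,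
    hprod, Nat.cast_zero, add_zero, add_zero, Gamma_nat_eq_factorial, div_pow, pow_mul 2]
  have := n.factorial_ne_zero
  have := (2 * n).factorial_ne_zero
  field_simp
  norm_num

theorem continuous_besselI_zero : Continuous (besselI 0) := by
  rw [show besselI 0 = _ from funext besselI_zero_eq_integral]
  exact continuous_const.mul
    (intervalIntegral.continuous_parametric_intervalIntegral_of_continuous'
      (by fun_prop : Continuous (Function.uncurry fun x θ : ℝ => cosh (x * cos θ))) _ _)

/-- After scaling the angle by `√x`, the integrand of `√x * exp (-x) * besselI 0 x`. -/
noncomputable def besselKernel (x u : ℝ) : ℝ :=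
  (Ioc (-(π / 2) * √x) (π / 2 * √x)).indicator
    (fun u => exp (-x) * cosh (x * cos (u / √x))) u

theorem sqrt_mul_exp_mul_besselI_zero {x : ℝ} (hx : 0 < x) :
    √x * (exp (-x) * besselI 0 x) = π⁻¹ * ∫ u, besselKernel x u := by
  have hs : 0 < √x := sqrt_pos.2 hx
  have h := intervalIntegral.integral_comp_div (a := -(π / 2) * √x) (b := π / 2 * √x)
    (fun θ => exp (-x) * cosh (x * cos θ)) hs.ne'
  rw [mul_div_cancel_right₀ _ hs.ne', mul_div_cancel_right₀ _ hs.ne',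
    intervalIntegral.integral_const_mul (exp (-x)) fun θ => cosh (x * cos θ),
    intervalIntegral.integral_of_le
      (by nlinarith [mul_pos pi_pos hs]), ← integral_indicator measurableSet_Ioc, smul_eq_mul] at h
  rw [besselI_zero_eq_integral]
  unfold besselKernel
  rw [h]
  ring

theorem besselKernel_nonneg (x u : ℝ) : 0 ≤ besselKernel x u :=
  indicator_nonneg (fun _ _ => mul_nonneg (exp_pos _).le (cosh_pos _).le) _

theorem measurable_besselKernel (x : ℝ) : Measurable (besselKernel x) :=
  (by fun_prop : Continuous fun u => exp (-x) * cosh (x * cos (u / √x))).measurable.indicator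
    measurableSet_Ioc

theorem besselKernel_le {x : ℝ} (hx : 0 < x) (u : ℝ) :
    besselKernel x u ≤ exp (-(2 / π ^ 2) * u ^ 2) := by
  by_cases hu : u ∈ Ioc (-(π / 2) * √x) (π / 2 * √x)
  swap
  · rw [besselKernel, indicator_of_notMem hu]
    exact (exp_pos _).le
  rw [besselKernel, indicator_of_mem hu]
  have hs : 0 < √x := sqrt_pos.2 hx
  have habs : |u / √x| ≤ π / 2 := by
    rw [abs_le, le_div_iff₀ hs, div_le_iff₀ hs]
    exact ⟨hu.1.le, hu.2⟩
  have hcos : 0 ≤ x * cos (u / √x) :=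
    mul_nonneg hx.le (cos_nonneg_of_neg_pi_div_two_le_of_le (abs_le.1 habs).1 (abs_le.1 habs).2)
  have hcosh : cosh (x * cos (u / √x)) ≤ exp (x * cos (u / √x)) := by
    rw [cosh_eq]
    have : exp (-(x * cos (u / √x))) ≤ exp (x * cos (u / √x)) := exp_le_exp.2 (by linarith)
    linarith
  calc exp (-x) * cosh (x * cos (u / √x))
      ≤ exp (-x) * exp (x * cos (u / √x)) := by gcongr
    _ = exp (-x + x * cos (u / √x)) := (exp_add _ _).symm
    _ ≤ _ := by
      refine exp_le_exp.2 ?_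
      have h := mul_le_mul_of_nonneg_left
        (cos_le_one_sub_mul_cos_sq (x := u / √x) (habs.trans (by linarith [pi_pos]))) hx.le
      have hx2 : x * (u / √x) ^ 2 = u ^ 2 := by
        rw [div_pow, sq_sqrt hx.le]; field_simp
      linear_combination h - 2 / π ^ 2 * hx2

theorem tendsto_besselKernel (u : ℝ) :
    Tendsto (fun x => besselKernel x u) atTop (𝓝 (exp (-(1 / 2) * u ^ 2) / 2)) := by
  have hmem : ∀ᶠ x in atTop, u ∈ Ioc (-(π / 2) * √x) (π / 2 * √x) := by
    have h := (tendsto_sqrt_atTop.const_mul_atTop (half_pos pi_pos)).eventually_gt_atTop |u|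
    filter_upwards [h] with x hx
    rw [abs_lt] at hx
    exact ⟨by linarith, hx.2.le⟩
  have hscale (c : ℝ) : Tendsto (fun x : ℝ => c / √x) atTop (𝓝 0) :=
    tendsto_sqrt_atTop.const_div_atTop c
  have hsinc : Tendsto (fun x : ℝ => -(1 / 2) * u ^ 2 * sinc (u / 2 / √x) ^ 2) atTop
      (𝓝 (-(1 / 2) * u ^ 2)) := by
    have h := ((continuous_sinc.tendsto 0).comp (hscale (u / 2))).pow 2
    simpa only [Function.comp_def, sinc_zero, one_pow, mul_one] using h.const_mul (-(1 / 2) * u ^ 2)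
  have hmain : Tendsto (fun x : ℝ => exp (-x + x * cos (u / √x))) atTop
      (𝓝 (exp (-(1 / 2) * u ^ 2))) := by
    refine (continuous_exp.tendsto _).comp (hsinc.congr' ?_)
    filter_upwards [eventually_gt_atTop 0] with x hx
    have hs : 0 < √x := sqrt_pos.2 hx
    have hcos : cos (u / √x) = 1 - 2 * (u / 2 / √x * sinc (u / 2 / √x)) ^ 2 := by
      rw [show u / √x = 2 * (u / 2 / √x) by ring, cos_two_mul, cos_sq']
      by_cases h0 : u / 2 / √x = 0
      · simp [h0]; norm_num
      · rw [sinc_of_ne_zero h0, mul_div_cancel₀ _ h0]; ring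
    rw [hcos, mul_pow, div_pow, sq_sqrt hx.le]
    field_simp
    ring
  have hsmall : Tendsto (fun x : ℝ => exp (-x - x * cos (u / √x))) atTop (𝓝 0) := by
    have hcos : ∀ᶠ x in atTop, 0 < cos (u / √x) :=
      ((continuous_cos.tendsto 0).comp (hscale u)).eventually_const_lt (by simp)
    refine squeeze_zero' (Eventually.of_forall fun x => (exp_pos _).le) ?_
      tendsto_exp_neg_atTop_nhds_zero
    filter_upwards [hcos, eventually_gt_atTop 0] with x hc hx
    exact exp_le_exp.2 (by nlinarith [mul_pos hx hc])
  have h := (hmain.add hsmall).div_const 2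
  rw [add_zero] at h
  refine h.congr' ?_
  filter_upwards [hmem] with x hx
  rw [besselKernel, indicator_of_mem hx, cosh_eq, exp_add, sub_eq_add_neg, exp_add]
  ring

theorem tendsto_sqrt_mul_exp_mul_besselI_zero :
    Tendsto (fun x => √x * (exp (-x) * besselI 0 x)) atTop (𝓝 (√(2 * π))⁻¹) := by
  have h := tendsto_integral_filter_of_dominated_convergence (μ := volume) (l := atTop)
    (F := besselKernel) (f := fun u => exp (-(1 / 2) * u ^ 2) / 2)
    (fun u => exp (-(2 / π ^ 2) * u ^ 2))
    (Eventually.of_forall fun x => (measurable_besselKernel x).aestronglyMeasurable)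
    ((eventually_gt_atTop 0).mono fun x hx => Eventually.of_forall fun u => by
      rw [norm_of_nonneg (besselKernel_nonneg x u)]
      exact besselKernel_le hx u)
    (integrable_exp_neg_mul_sq (by positivity))
    (Eventually.of_forall tendsto_besselKernel)
  rw [integral_div, integral_gaussian] at h
  have hval : π⁻¹ * (√(π / (1 / 2)) / 2) = (√(2 * π))⁻¹ := by
    rw [show π / (1 / 2) = 2 * π by ring]
    have := mul_self_sqrt (by positivity : 0 ≤ 2 * π)
    field_simp
    rw [mul_comm π, pow_two]
    linarith
  rw [← hval]
  refine (h.const_mul π⁻¹).congr' ?_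
  filter_upwards [eventually_gt_atTop 0] with x hx
  exact (sqrt_mul_exp_mul_besselI_zero hx).symm

theorem exp_mul_besselI_zero_nonneg (x : ℝ) : 0 ≤ exp (-x) * besselI 0 x := by
  rw [besselI_zero_eq_integral]
  have := intervalIntegral.integral_nonneg (μ := volume) (a := -(π / 2)) (b := π / 2)
    (f := fun θ => cosh (x * cos θ)) (by linarith [pi_pos]) fun θ _ => (cosh_pos _).le
  positivity

theorem exists_sqrt_one_add_mul_exp_mul_besselI_zero_le :
    ∃ C, ∀ x, 0 ≤ x → √(1 + x) * (exp (-x) * besselI 0 x) ≤ C := by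
  set h : ℝ → ℝ := fun x => exp (-x) * besselI 0 x
  have hcont : Continuous fun x => √(1 + x) * h x :=
    (by fun_prop : Continuous fun x : ℝ => √(1 + x)).mul
      ((by fun_prop : Continuous fun x : ℝ => exp (-x)).mul continuous_besselI_zero)
  obtain ⟨M, hM⟩ := (tendsto_sqrt_mul_exp_mul_besselI_zero.eventually_le_const
    (lt_add_one _)).exists_forall_of_atTop
  obtain ⟨B, hB⟩ := (isCompact_Icc (a := (0 : ℝ)) (b := max M 1)).bddAbove_image
    hcont.continuousOn
  refine ⟨max B (√2 * ((√(2 * π))⁻¹ + 1)), fun x hx => ?_⟩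
  rcases le_total x (max M 1) with hxM | hxM
  · exact le_max_of_le_left (hB ⟨x, ⟨hx, hxM⟩, rfl⟩)
  · refine le_max_of_le_right ?_
    have hx1 : 1 ≤ x := (le_max_right _ _).trans hxM
    calc √(1 + x) * h x ≤ (√2 * √x) * h x := by
          refine mul_le_mul_of_nonneg_right ?_ (exp_mul_besselI_zero_nonneg x)
          rw [← sqrt_mul (by norm_num)]
          exact sqrt_le_sqrt (by linarith)
      _ = √2 * (√x * h x) := by ring
      _ ≤ _ := by gcongr; exact hM x ((le_max_left _ _).trans hxM)

theorem tendsto_sqrt_mul_exp_mul_integral_besselI_zero :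
    Tendsto (fun κ : ℝ => √κ * exp (-κ) * ∫ s in (0 : ℝ)..κ, besselI 0 s) atTop
      (𝓝 (√(2 * π))⁻¹) := by
  obtain ⟨C, hC⟩ := exists_sqrt_one_add_mul_exp_mul_besselI_zero_le
  have hC0 : 0 ≤ C :=
    (mul_nonneg (sqrt_nonneg _) (exp_mul_besselI_zero_nonneg 0)).trans (hC 0 le_rfl)
  set h : ℝ → ℝ := fun x => exp (-x) * besselI 0 x
  have hcont : Continuous h :=
    (by fun_prop : Continuous fun x : ℝ => exp (-x)).mul continuous_besselI_zero
  have hlim := tendsto_integral_filter_of_dominated_convergence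
    (μ := volume.restrict (Ioi 0)) (l := atTop)
    (F := fun κ : ℝ => (Ioc 0 κ).indicator fun t => exp (-t) * (√κ * h (κ - t)))
    (f := fun t => exp (-t) * (√(2 * π))⁻¹) (fun t => C * (exp (-t) + exp (-t) * t ^ ((2 : ℝ) - 1)))
    (Eventually.of_forall fun κ => ((by fun_prop : Continuous
      fun t => exp (-t) * (√κ * h (κ - t))).measurable.indicator
        measurableSet_Ioc).aestronglyMeasurable)
    ?_ ?_ ?_
  · rw [integral_mul_const, integral_exp_neg_Ioi_zero, one_mul] at hlim
    refine hlim.congr' ?_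
    filter_upwards [eventually_gt_atTop 0] with κ hκ
    rw [integral_indicator measurableSet_Ioc, Measure.restrict_restrict measurableSet_Ioc,
      inter_eq_left.2 Ioc_subset_Ioi_self, ← intervalIntegral.integral_of_le hκ.le,
      ← intervalIntegral.integral_const_mul]
    have hrefl := intervalIntegral.integral_comp_sub_left (a := 0) (b := κ)
      (fun s => √κ * exp (-κ) * besselI 0 s) κ
    rw [sub_self, sub_zero] at hrefl
    rw [← hrefl]
    congr 1 with t
    simp only [h]
    rw [show -κ = -t + -(κ - t) by ring, exp_add]
    ring_nf
  · filter_upwards [eventually_gt_atTop 0] with κ hκ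
    filter_upwards [ae_restrict_mem measurableSet_Ioi] with t ht
    rw [mem_Ioi] at ht
    by_cases htκ : t ∈ Ioc 0 κ
    · have hd : 0 ≤ κ - t := sub_nonneg.2 htκ.2
      have hsqrt : √κ ≤ (1 + t) * √(1 + (κ - t)) := by
        rw [← sqrt_sq (by linarith : 0 ≤ 1 + t), ← sqrt_mul (sq_nonneg _)]
        exact sqrt_le_sqrt (by nlinarith [mul_nonneg ht.le hd])
      have hh : 0 ≤ h (κ - t) := exp_mul_besselI_zero_nonneg _
      rw [indicator_of_mem htκ, norm_of_nonneg (by positivity)]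
      calc exp (-t) * (√κ * h (κ - t))
          ≤ exp (-t) * ((1 + t) * √(1 + (κ - t)) * h (κ - t)) := by gcongr
        _ = exp (-t) * ((1 + t) * (√(1 + (κ - t)) * h (κ - t))) := by ring
        _ ≤ exp (-t) * ((1 + t) * C) := by gcongr; exact hC _ hd
        _ = C * (exp (-t) + exp (-t) * t ^ ((2 : ℝ) - 1)) := by
          rw [show (2 : ℝ) - 1 = 1 by norm_num, rpow_one]; ring
    · rw [indicator_of_notMem htκ, norm_zero]
      positivity
  · have h1 : IntegrableOn (fun t : ℝ => exp (-t)) (Ioi 0) := integrableOn_exp_neg_Ioi 0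
    exact (h1.add (GammaIntegral_convergent (by norm_num : (0 : ℝ) < 2))).const_mul C
  · filter_upwards [ae_restrict_mem measurableSet_Ioi] with t ht
    rw [mem_Ioi] at ht
    have hsub : Tendsto (fun κ : ℝ => κ - t) atTop atTop := tendsto_atTop_add_const_right _ _ tendsto_id
    have hratio : Tendsto (fun κ : ℝ => √(1 + t / (κ - t))) atTop (𝓝 1) := by
      simpa using ((hsub.const_div_atTop t).const_add 1).sqrt
    have hprod := (hratio.mul (tendsto_sqrt_mul_exp_mul_besselI_zero.comp hsub)).const_mul (exp (-t))
    rw [one_mul] at hprod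
    refine hprod.congr' ?_
    filter_upwards [eventually_gt_atTop t] with κ hκ
    have hd : 0 < κ - t := sub_pos.2 hκ
    rw [indicator_of_mem (show t ∈ Ioc 0 κ from ⟨ht, hκ.le⟩), Function.comp_apply, ← mul_assoc √_,
      ← sqrt_mul (by positivity), add_mul, div_mul_cancel₀ _ hd.ne', one_mul, sub_add_cancel]

theorem integral_besselI_zero_asymptotics :
    Filter.Tendsto (fun κ : ℝ => Real.sqrt (2 * Real.pi * κ) * Real.exp (-κ) *
      ∫ s in (0 : ℝ)..κ, besselI 0 s) Filter.atTop (nhds 1) := by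
  have h := tendsto_sqrt_mul_exp_mul_integral_besselI_zero.const_mul √(2 * π)
  rw [mul_inv_cancel₀ (by positivity)] at h
  refine h.congr fun κ => ?_
  rw [sqrt_mul (by positivity : 0 ≤ 2 * π)]
  ring
end
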